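/- arXiv:2503.18618 — 3 statements merged into one kernel-verified Lean document; each statement's English description precedes it below -/
import Mathlib

section
/- Let n, m ≥ 1 and let A = (A_1,…,A_m) and B = (B_1,…,B_m) be m-tuples of n×n real matrices. Then there exists an orthogonal matrix U ∈ O(n, ℝ) with Uᵀ A_i U = B_i for all i = 1,…,m if and only if for every nonempty word ω of length at most n² in 2m non-commuting letters one has tr(ω(A_1,…,A_m, A_1ᵀ,…,A_mᵀ)) = tr(ω(B_1,…,B_m, B_1ᵀ,…,B_mᵀ)), where ω(X_1,…,X_{2m}) denotes the product of matrices obtained by substituting X_j for the j-th letter of ω. -/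
open Matrix

section Representation

variable {R E E' : Type*} [Ring R] [Algebra ℝ R]
  [NormedAddCommGroup E] [InnerProductSpace ℝ E]
  [NormedAddCommGroup E'] [InnerProductSpace ℝ E']

/-- The restriction of a representation to an invariant subspace. -/
def restrictRep (ρ : R →ₐ[ℝ] Module.End ℝ E) (K : Submodule ℝ E)
    (h : ∀ r, ∀ x ∈ K, ρ r x ∈ K) : R →ₐ[ℝ] Module.End ℝ K where
  toFun r := (ρ r).restrict (h r)
  map_one' := by ext; simp
  map_mul' r s := by ext; simp
  map_zero' := by ext; simp
  map_add' r s := by ext; simp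
  commutes' c := by ext; simp [Algebra.algebraMap_eq_smul_one]

@[simp]
lemma coe_restrictRep_apply (ρ : R →ₐ[ℝ] Module.End ℝ E) (K : Submodule ℝ E)
    (h : ∀ r, ∀ x ∈ K, ρ r x ∈ K) (r : R) (x : K) :
    (restrictRep ρ K h r x : E) = ρ r x := rfl

lemma trace_eq_add_orthogonal [FiniteDimensional ℝ E] (ρ : R →ₐ[ℝ] Module.End ℝ E)
    (K : Submodule ℝ E) (h : ∀ r, ∀ x ∈ K, ρ r x ∈ K) (h' : ∀ r, ∀ x ∈ Kᗮ, ρ r x ∈ Kᗮ) (r : R) :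
    LinearMap.trace ℝ E (ρ r) = LinearMap.trace ℝ K (restrictRep ρ K h r) +
      LinearMap.trace ℝ Kᗮ (restrictRep ρ Kᗮ h' r) := by
  rw [← LinearMap.trace_prodMap', ← LinearMap.trace_conj' _
    (Submodule.prodEquivOfIsCompl K Kᗮ K.isCompl_orthogonal)]
  congr 1
  refine LinearMap.ext fun x => ?_
  obtain ⟨⟨y, z⟩, rfl⟩ := (Submodule.prodEquivOfIsCompl K Kᗮ K.isCompl_orthogonal).surjective x
  simp [LinearEquiv.conj_apply]

lemma eq_zero_of_trace_adjoint_comp [FiniteDimensional ℝ E] {S T : Module.End ℝ E}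
    (h : ∀ x y, inner ℝ (T x) y = inner ℝ x (S y))
    (h0 : LinearMap.trace ℝ E (S * T) = 0) : T = 0 := by
  let b := stdOrthonormalBasis ℝ E
  rw [LinearMap.trace_eq_sum_inner _ b] at h0
  have h1 : ∀ i, inner ℝ (b i) ((S * T) (b i)) = ‖T (b i)‖ ^ 2 := fun i => by
    rw [Module.End.mul_apply, ← h, real_inner_self_eq_norm_sq]
  simp only [h1] at h0
  refine b.toBasis.ext fun i => ?_
  have := (Finset.sum_eq_zero_iff_of_nonneg fun i _ => sq_nonneg _).1 h0 i (Finset.mem_univ _)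
  simpa using this

lemma rep_eq_zero_of_trace_eq [FiniteDimensional ℝ E] [FiniteDimensional ℝ E']
    (ρ : R →ₐ[ℝ] Module.End ℝ E) (ρ' : R →ₐ[ℝ] Module.End ℝ E') (st : R → R)
    (hst' : ∀ r x y, inner ℝ (ρ' r x) y = inner ℝ x (ρ' (st r) y))
    (htr : ∀ r, LinearMap.trace ℝ E (ρ r) = LinearMap.trace ℝ E' (ρ' r))
    {r : R} (hr : ρ r = 0) : ρ' r = 0 := by
  refine eq_zero_of_trace_adjoint_comp (hst' r) ?_
  rw [← map_mul, ← htr, map_mul, hr, mul_zero, map_zero]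

/-- Among the nonzero operators of a representation, one of minimal rank compresses every
symmetric operator to a scalar. -/
lemma exists_scalar_compression [FiniteDimensional ℝ E]
    (ρ : R →ₐ[ℝ] Module.End ℝ E) (st : R → R)
    (hst : ∀ r x y, inner ℝ (ρ r x) y = inner ℝ x (ρ (st r) y)) {e : R} (he : ρ e ≠ 0)
    (hmin : ∀ r, ρ r ≠ 0 →
      Module.finrank ℝ (LinearMap.ker (ρ r)) ≤ Module.finrank ℝ (LinearMap.ker (ρ e)))
    {s : R} (hs : (ρ s).IsSymmetric) : ∃ c : ℝ, ρ (st e * (s - algebraMap ℝ R c) * e) = 0 := by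
  let L := LinearMap.range (ρ e)
  let T : L →ₗ[ℝ] L := (L.orthogonalProjectionOnto : E →ₗ[ℝ] L) ∘ₗ ρ s ∘ₗ L.subtype
  have hT : T.IsSymmetric := fun x y => by
    simp only [T, LinearMap.comp_apply, Submodule.subtype_apply]
    have h1 : inner ℝ (L.orthogonalProjectionOnto (ρ s x)) y = inner ℝ (ρ s x) (y : E) := by simp
    have h2 : inner ℝ x (L.orthogonalProjectionOnto (ρ s y)) = inner ℝ (x : E) (ρ s y) := by simp
    exact h1.trans ((hs _ _).trans h2.symm)
  have : Nontrivial L := by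
    rw [Submodule.nontrivial_iff_ne_bot]
    exact fun h => he (LinearMap.range_eq_bot.1 h)
  obtain ⟨⟨_, u, rfl⟩, hv⟩ := hT.hasEigenvalue_iSup_of_finiteDimensional.exists_hasEigenvector
  generalize (⨆ x : { x : L // x ≠ 0 }, _ : ℝ) = c at hv
  refine ⟨c, ?_⟩
  by_contra hne
  have hu : ρ e u ≠ 0 := fun h => hv.2 (Subtype.ext h)
  refine absurd (hmin _ hne) (not_le.2 (Submodule.finrank_lt_finrank_of_lt ?_))
  have hker : ρ (st e * (s - algebraMap ℝ R c) * e) u = 0 := by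
    refine ext_inner_left ℝ fun w => ?_
    have h1 := congrArg (fun z : L => inner ℝ (⟨ρ e w, w, rfl⟩ : L) z) hv.apply_eq_smul
    simp only [T, LinearMap.comp_apply, Submodule.subtype_apply] at h1
    have h2 : inner ℝ (⟨ρ e w, w, rfl⟩ : L) (L.orthogonalProjectionOnto (ρ s (ρ e u)))
      = inner ℝ (ρ e w) (ρ s (ρ e u)) := by simp
    have h3 : inner ℝ (ρ e w) (ρ s (ρ e u)) = inner ℝ (ρ e w) (c • ρ e u) := h2.symm.trans h1
    rw [mul_assoc, map_mul, Module.End.mul_apply, ← hst]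
    simp [h3, Algebra.algebraMap_eq_smul_one, inner_sub_right]
  refine lt_of_le_of_ne (fun x hx => ?_) fun h => ?_
  · rw [LinearMap.mem_ker] at hx ⊢
    simp [hx]
  · have : u ∈ LinearMap.ker (ρ e) := h ▸ hker
    exact hu this

lemma exists_vectors_norm_eq [FiniteDimensional ℝ E] [FiniteDimensional ℝ E'] [Nontrivial E]
    (ρ : R →ₐ[ℝ] Module.End ℝ E) (ρ' : R →ₐ[ℝ] Module.End ℝ E') (st : R → R)
    (hst : ∀ r x y, inner ℝ (ρ r x) y = inner ℝ x (ρ (st r) y))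
    (hst' : ∀ r x y, inner ℝ (ρ' r x) y = inner ℝ x (ρ' (st r) y))
    (htr : ∀ r, LinearMap.trace ℝ E (ρ r) = LinearMap.trace ℝ E' (ρ' r)) :
    ∃ (v : E) (v' : E'), v ≠ 0 ∧ ∀ r, ‖ρ r v‖ = ‖ρ' r v'‖ := by
  obtain ⟨e, he, hmin⟩ : ∃ e, ρ e ≠ 0 ∧ ∀ r, ρ r ≠ 0 →
      Module.finrank ℝ (LinearMap.ker (ρ r)) ≤ Module.finrank ℝ (LinearMap.ker (ρ e)) := by
    obtain ⟨_, ⟨e, he, rfl⟩, hmax⟩ := Set.Finite.exists_maximal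
      (s := (fun r => Module.finrank ℝ (LinearMap.ker (ρ r))) '' {r | ρ r ≠ 0})
      ((Set.finite_Iic (Module.finrank ℝ E)).subset (by
        rintro _ ⟨r, -, rfl⟩
        exact Submodule.finrank_le _)) ⟨_, 1, by simp, rfl⟩
    refine ⟨e, he, fun r hr => ?_⟩
    by_contra! h
    exact absurd (hmax ⟨r, hr, rfl⟩ h.le) (not_le.2 h)
  have he' : ρ' e ≠ 0 := fun h =>
    he (rep_eq_zero_of_trace_eq ρ' ρ st hst (fun r => (htr r).symm) h)
  have key : ∀ {u : E} {u' : E'} (r : R), ∃ c : ℝ,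
      ‖ρ r (ρ e u)‖ ^ 2 = c * ‖ρ e u‖ ^ 2 ∧ ‖ρ' r (ρ' e u')‖ ^ 2 = c * ‖ρ' e u'‖ ^ 2 := by
    intro u u' r
    have hs : (ρ (st r * r)).IsSymmetric := fun x y => by
      rw [map_mul, Module.End.mul_apply, Module.End.mul_apply, ← hst, real_inner_comm, ← hst,
        real_inner_comm]
    obtain ⟨c, hc⟩ := exists_scalar_compression ρ st hst he hmin hs
    have hc' := rep_eq_zero_of_trace_eq ρ ρ' st hst' htr hc
    refine ⟨c, ?_, ?_⟩
    · have h := congrArg (fun T => inner ℝ u (T u)) hc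
      simp only [mul_assoc, map_mul, Module.End.mul_apply, ← hst] at h
      simp [inner_sub_right, ← hst, Algebra.algebraMap_eq_smul_one, inner_smul_right] at h
      linarith
    · have h := congrArg (fun T => inner ℝ u' (T u')) hc'
      simp only [mul_assoc, map_mul, Module.End.mul_apply, ← hst'] at h
      simp [inner_sub_right, ← hst', Algebra.algebraMap_eq_smul_one, inner_smul_right] at h
      linarith
  obtain ⟨u, hu⟩ : ∃ u, ρ e u ≠ 0 := by
    by_contra! h
    exact he (LinearMap.ext h)
  obtain ⟨u', hu'⟩ : ∃ u, ρ' e u ≠ 0 := by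
    by_contra! h
    exact he' (LinearMap.ext h)
  refine ⟨ρ e (‖ρ e u‖⁻¹ • u), ρ' e (‖ρ' e u'‖⁻¹ • u'), by simpa using hu, fun r => ?_⟩
  obtain ⟨c, h1, h2⟩ := key (u := ‖ρ e u‖⁻¹ • u) (u' := ‖ρ' e u'‖⁻¹ • u') r
  have h3 : ‖ρ e (‖ρ e u‖⁻¹ • u)‖ = 1 := by
    rw [map_smul, norm_smul, norm_inv, norm_norm, inv_mul_cancel₀ (norm_ne_zero_iff.2 hu)]
  have h4 : ‖ρ' e (‖ρ' e u'‖⁻¹ • u')‖ = 1 := by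
    rw [map_smul, norm_smul, norm_inv, norm_norm, inv_mul_cancel₀ (norm_ne_zero_iff.2 hu')]
  rw [h3] at h1
  rw [h4] at h2
  exact (sq_eq_sq₀ (norm_nonneg _) (norm_nonneg _)).1 (h1.trans h2.symm)

lemma exists_linearIsometryEquiv_range {V : Type*} [AddCommGroup V] [Module ℝ V]
    (f : V →ₗ[ℝ] E) (f' : V →ₗ[ℝ] E') (h : ∀ x, ‖f x‖ = ‖f' x‖) :
    ∃ φ : LinearMap.range f ≃ₗᵢ[ℝ] LinearMap.range f',
      ∀ x, φ (f.rangeRestrict x) = f'.rangeRestrict x := by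
  have hk : LinearMap.ker f = LinearMap.ker f' := by
    ext x
    rw [LinearMap.mem_ker, LinearMap.mem_ker, ← norm_eq_zero, h, norm_eq_zero]
  let φ := f.quotKerEquivRange.symm ≪≫ₗ Submodule.quotEquivOfEq _ _ hk ≪≫ₗ f'.quotKerEquivRange
  have hφ : ∀ x, φ (f.rangeRestrict x) = f'.rangeRestrict x := fun x => by
    have : f.quotKerEquivRange.symm (f.rangeRestrict x) = Submodule.Quotient.mk x := by
      rw [LinearEquiv.symm_apply_eq]; rfl
    simp only [φ, LinearEquiv.trans_apply, this]
    rfl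
  refine ⟨⟨φ, ?_⟩, hφ⟩
  rintro ⟨_, x, rfl⟩
  exact (congrArg norm (hφ x)).trans (h x).symm

lemma norm_sq_coe_add_coe_orthogonal (K : Submodule ℝ E) (y : K) (z : Kᗮ) :
    ‖(y + z : E)‖ ^ 2 = ‖y‖ ^ 2 + ‖z‖ ^ 2 := by
  simp only [sq]
  exact norm_add_sq_eq_norm_sq_add_norm_sq_real (K.inner_right_of_mem_orthogonal y.2 z.2)

theorem exists_linearIsometry_intertwining [FiniteDimensional ℝ E] [FiniteDimensional ℝ E']
    (ρ : R →ₐ[ℝ] Module.End ℝ E) (ρ' : R →ₐ[ℝ] Module.End ℝ E') (st : R → R)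
    (hst : ∀ r x y, inner ℝ (ρ r x) y = inner ℝ x (ρ (st r) y))
    (hst' : ∀ r x y, inner ℝ (ρ' r x) y = inner ℝ x (ρ' (st r) y))
    (htr : ∀ r, LinearMap.trace ℝ E (ρ r) = LinearMap.trace ℝ E' (ρ' r)) :
    ∃ Φ : E →ₗᵢ[ℝ] E', ∀ r x, Φ (ρ r x) = ρ' r (Φ x) := by
  induction hd : Module.finrank ℝ E using Nat.strong_induction_on generalizing E E' with
  | _ d ih =>
  rcases subsingleton_or_nontrivial E with hE | hE
  · refine ⟨⟨0, fun x => by simp [Subsingleton.elim x 0]⟩, fun r x => by simp⟩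
  obtain ⟨v, v', hv, hvv⟩ := exists_vectors_norm_eq ρ ρ' st hst hst' htr
  let f : R →ₗ[ℝ] E := (LinearMap.applyₗ v).comp ρ.toLinearMap
  let f' : R →ₗ[ℝ] E' := (LinearMap.applyₗ v').comp ρ'.toLinearMap
  let K := LinearMap.range f
  let K' := LinearMap.range f'
  obtain ⟨φ, hφ⟩ : ∃ φ : K ≃ₗᵢ[ℝ] K', ∀ x, φ (f.rangeRestrict x) = f'.rangeRestrict x :=
    exists_linearIsometryEquiv_range f f' hvv
  have hinv : ∀ r, ∀ x ∈ K, ρ r x ∈ K := by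
    rintro r _ ⟨y, rfl⟩
    exact ⟨r * y, by simp [f]⟩
  have hinv' : ∀ r, ∀ x ∈ K', ρ' r x ∈ K' := by
    rintro r _ ⟨y, rfl⟩
    exact ⟨r * y, by simp [f']⟩
  have hort : ∀ r, ∀ x ∈ Kᗮ, ρ r x ∈ Kᗮ := fun r x hx => by
    rw [Submodule.mem_orthogonal'] at hx ⊢
    exact fun y hy => (hst r x y).trans (hx _ (hinv _ _ hy))
  have hort' : ∀ r, ∀ x ∈ K'ᗮ, ρ' r x ∈ K'ᗮ := fun r x hx => by
    rw [Submodule.mem_orthogonal'] at hx ⊢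
    exact fun y hy => (hst' r x y).trans (hx _ (hinv' _ _ hy))
  have hφρ : ∀ r (x : K), φ (restrictRep ρ K hinv r x) = restrictRep ρ' K' hinv' r (φ x) := by
    rintro r ⟨_, y, rfl⟩
    have h1 : restrictRep ρ K hinv r (f.rangeRestrict y) = f.rangeRestrict (r * y) :=
      Subtype.ext (by simp [f])
    change φ (restrictRep ρ K hinv r (f.rangeRestrict y)) =
      restrictRep ρ' K' hinv' r (φ (f.rangeRestrict y))
    rw [h1, hφ, hφ]
    exact Subtype.ext (by simp [f'])
  have htrK : ∀ r, LinearMap.trace ℝ K (restrictRep ρ K hinv r) =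
      LinearMap.trace ℝ K' (restrictRep ρ' K' hinv' r) := fun r => by
    rw [← LinearMap.trace_conj' _ φ.toLinearEquiv]
    congr 1
    refine LinearMap.ext fun x => ?_
    simp [LinearEquiv.conj_apply, hφρ]
  have hlt : Module.finrank ℝ Kᗮ < d := by
    have h1 := K.finrank_add_finrank_orthogonal
    have h2 : 0 < Module.finrank ℝ K := by
      rw [Module.finrank_pos_iff, Submodule.nontrivial_iff_ne_bot, Submodule.ne_bot_iff]
      exact ⟨v, ⟨1, by simp [f]⟩, hv⟩
    omega
  obtain ⟨Ψ, hΨ⟩ := ih _ hlt (restrictRep ρ Kᗮ hort) (restrictRep ρ' K'ᗮ hort')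
    (fun r x y => hst r x y) (fun r x y => hst' r x y) (fun r => by
      have h1 := trace_eq_add_orthogonal ρ K hinv hort r
      have h2 := trace_eq_add_orthogonal ρ' K' hinv' hort' r
      rw [htr, htrK] at h1
      linarith) rfl
  let Φ : E →ₗ[ℝ] E' := K'.subtype ∘ₗ φ.toLinearEquiv.toLinearMap ∘ₗ
      (K.orthogonalProjectionOnto : E →ₗ[ℝ] K) +
    K'ᗮ.subtype ∘ₗ Ψ.toLinearMap ∘ₗ (Kᗮ.orthogonalProjectionOnto : E →ₗ[ℝ] Kᗮ)
  have hΦ : ∀ (y : K) (z : Kᗮ), Φ (y + z) = φ y + Ψ z := fun y z => by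
    have h1 : Kᗮ.orthogonalProjectionOnto (y : E) = 0 :=
      Submodule.orthogonalProjectionOnto_eq_zero_iff.2
        (by rw [Submodule.orthogonal_orthogonal]; exact y.2)
    have h2 : K.orthogonalProjectionOnto (z : E) = 0 :=
      Submodule.orthogonalProjectionOnto_eq_zero_iff.2 z.2
    simp [Φ, h1, h2]
  have hdec : ∀ x : E, ∃ (y : K) (z : Kᗮ), x = y + z := fun x =>
    ⟨_, _, (K.starProjection_add_starProjection_orthogonal x).symm⟩
  refine ⟨⟨Φ, fun x => ?_⟩, fun r x => ?_⟩
  · obtain ⟨y, z, rfl⟩ := hdec x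
    rw [hΦ, ← sq_eq_sq₀ (norm_nonneg _) (norm_nonneg _), norm_sq_coe_add_coe_orthogonal,
      norm_sq_coe_add_coe_orthogonal, φ.norm_map, Ψ.norm_map]
  · obtain ⟨y, z, rfl⟩ := hdec x
    have h1 := hΦ (restrictRep ρ K hinv r y) (restrictRep ρ Kᗮ hort r z)
    rw [hφρ, hΨ] at h1
    have h2 := congrArg (ρ' r) (hΦ y z)
    rw [map_add (ρ' r)] at h2
    change Φ (ρ r (y + z)) = ρ' r (Φ (y + z))
    rw [map_add (ρ r), h2]
    exact h1

end Representation

section Words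

variable {α R : Type*} [Ring R] [Algebra ℝ R]

/-- The span of the values of all words of length less than `j`. -/
def wordSpan (C : α → R) (j : ℕ) : Submodule ℝ R :=
  Submodule.span ℝ {x | ∃ w : List α, w.length < j ∧ (w.map C).prod = x}

/-- The words of length `j` span at most one dimension modulo the shorter words. -/
def GrowsByAtMostOne (C : α → R) (j : ℕ) : Prop :=
  ∃ w : List α, w.length = j ∧ ∀ u : List α, u.length = j →
    (u.map C).prod ∈ Submodule.span ℝ {(w.map C).prod} ⊔ wordSpan C j

lemma prod_mem_wordSpan (C : α → R) {j : ℕ} {w : List α} (h : w.length < j) :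
    (w.map C).prod ∈ wordSpan C j :=
  Submodule.subset_span ⟨w, h, rfl⟩

lemma wordSpan_mono (C : α → R) {i j : ℕ} (h : i ≤ j) : wordSpan C i ≤ wordSpan C j :=
  Submodule.span_mono fun _ ⟨w, hw, hx⟩ => ⟨w, hw.trans_le h, hx⟩

lemma mul_mem_wordSpan (C : α → R) {i j l : ℕ} {x y : R} (hx : x ∈ wordSpan C i)
    (hy : y ∈ wordSpan C j) (h : i + j ≤ l + 1) : x * y ∈ wordSpan C l := by
  have hxy := Submodule.mul_mem_mul hx hy
  rw [wordSpan, wordSpan, Submodule.span_mul_span] at hxy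
  refine Submodule.span_mono ?_ hxy
  rintro _ ⟨_, ⟨w, hw, rfl⟩, _, ⟨v, hv, rfl⟩, rfl⟩
  exact ⟨w ++ v, by rw [List.length_append]; omega, by simp⟩

lemma map_wordSpan {R' : Type*} [Ring R'] [Algebra ℝ R'] (f : R →ₐ[ℝ] R') (C : α → R) (j : ℕ) :
    (wordSpan C j).map f.toLinearMap = wordSpan (f ∘ C) j := by
  rw [wordSpan, Submodule.map_span, wordSpan]
  congr 1
  ext x
  simp only [Set.mem_image, Set.mem_ofPred_eq, AlgHom.toLinearMap_apply]
  constructor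
  · rintro ⟨_, ⟨w, hw, rfl⟩, rfl⟩
    exact ⟨w, hw, by simp [map_list_prod]⟩
  · rintro ⟨w, hw, rfl⟩
    exact ⟨_, ⟨w, hw, rfl⟩, by simp [map_list_prod]⟩

lemma star_mem_wordSpan [StarRing R] [StarModule ℝ R] {C : α → R} {σ : α → α}
    (hσ : ∀ a, C (σ a) = star (C a)) {j : ℕ} {x : R} (hx : x ∈ wordSpan C j) :
    star x ∈ wordSpan C j := by
  induction hx using Submodule.span_induction with
  | zero => simp
  | add x y _ _ hx hy => rw [star_add]; exact add_mem hx hy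
  | smul c x _ hx => rw [star_smul]; exact Submodule.smul_mem _ _ hx
  | mem x hx =>
    obtain ⟨w, hw, rfl⟩ := hx
    have : star (w.map C).prod = ((w.reverse.map σ).map C).prod := by
      clear hw
      induction w with
      | nil => simp
      | cons a w ih => simp [ih, hσ]
    rw [this]
    exact prod_mem_wordSpan C (by simpa using hw)

lemma GrowsByAtMostOne.succ {C : α → R} {j : ℕ} (hj : 1 ≤ j) (h : GrowsByAtMostOne C j) :
    GrowsByAtMostOne C (j + 1) := by
  obtain ⟨w, hw, h⟩ := h
  obtain ⟨w', z, rfl⟩ : ∃ w' z, w = w' ++ [z] :=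
    ⟨_, _, (List.dropLast_append_getLast (List.ne_nil_of_length_pos (by omega))).symm⟩
  rw [List.length_append, List.length_singleton] at hw
  refine ⟨w' ++ [z] ++ [z], by simp [hw], fun u hu => ?_⟩
  obtain ⟨x, u, rfl⟩ := List.exists_cons_of_length_eq_add_one hu
  obtain ⟨_, h1, l, hl, h2⟩ := Submodule.mem_sup.1 (h u (by simpa using hu))
  obtain ⟨c, rfl⟩ := Submodule.mem_span_singleton.1 h1
  obtain ⟨_, h3, l', hl', h4⟩ := Submodule.mem_sup.1 (h (x :: w') (by simpa using hw))
  obtain ⟨c', rfl⟩ := Submodule.mem_span_singleton.1 h3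
  have hC : ∀ a, C a ∈ wordSpan C 2 := fun a => by
    simpa using prod_mem_wordSpan C (w := [a]) (j := 2) (by simp)
  refine Submodule.mem_sup.2 ⟨_, Submodule.mem_span_singleton.2 ⟨c * c', rfl⟩,
    c • (l' * C z) + C x * l,
    add_mem (Submodule.smul_mem _ _ (mul_mem_wordSpan C hl' (hC z) le_rfl))
      (mul_mem_wordSpan C (hC x) hl (by omega)), ?_⟩
  rw [List.map_cons, List.prod_cons, ← h2]
  simp only [List.map_append, List.map_cons, List.map_nil, List.prod_append, List.prod_cons,
    List.prod_nil, mul_one] at h4 ⊢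
  rw [mul_add, mul_smul_comm, ← mul_assoc (C x), ← h4]
  simp only [add_mul, smul_mul_assoc, smul_add, smul_smul, mul_assoc, add_assoc]

lemma GrowsByAtMostOne.mono {C : α → R} {i j : ℕ} (hi : 1 ≤ i) (hij : i ≤ j)
    (h : GrowsByAtMostOne C i) : GrowsByAtMostOne C j := by
  induction j, hij using Nat.le_induction with
  | base => exact h
  | succ j hj ih => exact ih.succ (hi.trans hj)

lemma finrank_wordSpan_add_two_le [Nonempty α] [FiniteDimensional ℝ R] {C : α → R} {j : ℕ}
    (h : ¬ GrowsByAtMostOne C j) :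
    Module.finrank ℝ (wordSpan C j) + 2 ≤ Module.finrank ℝ (wordSpan C (j + 1)) := by
  have h' : ∀ w : List α, w.length = j → ∃ u : List α, u.length = j ∧
      (u.map C).prod ∉ Submodule.span ℝ {(w.map C).prod} ⊔ wordSpan C j := by
    simpa [GrowsByAtMostOne] using h
  obtain ⟨w, hw, hw'⟩ := h' (List.replicate j (Classical.arbitrary α)) (by simp)
  obtain ⟨u, hu, hu'⟩ := h' w hw
  have h1 : wordSpan C j < Submodule.span ℝ {(w.map C).prod} ⊔ wordSpan C j :=
    lt_of_le_of_ne le_sup_right fun he => hw' (Submodule.mem_sup_right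
      (he ▸ Submodule.mem_sup_left (Submodule.mem_span_singleton_self _)))
  have h2 : Submodule.span ℝ {(w.map C).prod} ⊔ wordSpan C j < wordSpan C (j + 1) := by
    refine lt_of_le_of_ne (sup_le ?_ (wordSpan_mono C j.le_succ)) fun he => hu' ?_
    · rw [Submodule.span_singleton_le_iff_mem]
      exact prod_mem_wordSpan C (by omega)
    · rw [he]
      exact prod_mem_wordSpan C (by omega)
  have h3 := Submodule.finrank_lt_finrank_of_lt h1
  have h4 := Submodule.finrank_lt_finrank_of_lt h2
  omega

lemma two_mul_add_one_le_finrank_wordSpan [Nonempty α] [Nontrivial R] [FiniteDimensional ℝ R]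
    {C : α → R} {k : ℕ} (h : ∀ j, 1 ≤ j → j ≤ k → ¬ GrowsByAtMostOne C j) :
    2 * k + 1 ≤ Module.finrank ℝ (wordSpan C (k + 1)) := by
  induction k with
  | zero =>
    have : Nontrivial (wordSpan C 1) := by
      rw [Submodule.nontrivial_iff_ne_bot, Submodule.ne_bot_iff]
      exact ⟨1, by simpa using prod_mem_wordSpan C (w := []) (j := 1) (by simp), one_ne_zero⟩
    exact Module.finrank_pos (R := ℝ) (M := wordSpan C 1)
  | succ k ih =>
    have h1 := ih fun j hj hk => h j hj (hk.trans k.le_succ)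
    have h2 := finrank_wordSpan_add_two_le (h (k + 1) (by omega) le_rfl)
    omega

lemma pow_mem_wordSpan {n : ℕ} (A : α → Matrix (Fin n) (Fin n) ℝ) (a : α) {k : ℕ} (h : n ≤ k) :
    A a ^ k ∈ wordSpan A k := by
  have hpow : ∀ i j, i < j → A a ^ i ∈ wordSpan A j := fun i j hij => by
    simpa using prod_mem_wordSpan A (w := List.replicate i a) (j := j) (by simpa using hij)
  have hn : A a ^ n ∈ wordSpan A n := by
    have h0 := Matrix.aeval_self_charpoly (A a)
    have hd : (A a).charpoly.natDegree = n := by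
      simp
    rw [Polynomial.aeval_eq_sum_range, hd, Finset.sum_range_succ] at h0
    have hc : (A a).charpoly.coeff n = 1 := by
      have := (Matrix.charpoly_monic (A a)).coeff_natDegree
      rwa [hd] at this
    rw [hc, one_smul] at h0
    rw [eq_neg_of_add_eq_zero_right h0]
    exact neg_mem (Submodule.sum_mem _ fun i hi =>
      Submodule.smul_mem _ _ (hpow i n (Finset.mem_range.1 hi)))
  obtain ⟨i, rfl⟩ := Nat.exists_eq_add_of_le h
  rw [pow_add]
  exact mul_mem_wordSpan A hn (hpow i (i + 1) i.lt_succ_self) (by omega)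

end Words

section TracePairs

variable {α : Type*} {n : ℕ} {A B : α → Matrix (Fin n) (Fin n) ℝ} {σ : α → α} {N : ℕ}

local notation "𝕄" => Matrix (Fin n) (Fin n) ℝ

/-- The pair of letter evaluations, with values in the product algebra. -/
def letterPair (A B : α → Matrix (Fin n) (Fin n) ℝ) (a : α) :
    Matrix (Fin n) (Fin n) ℝ × Matrix (Fin n) (Fin n) ℝ := (A a, B a)

lemma prod_map_letterPair (w : List α) :
    (w.map (letterPair A B)).prod = ((w.map A).prod, (w.map B).prod) := by
  induction w with
  | nil => rfl
  | cons a w ih => simp [ih, letterPair]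

lemma exists_mem_wordSpan_fst_eq {j : ℕ} {x : 𝕄} (hx : x ∈ wordSpan A j) :
    ∃ p ∈ wordSpan (letterPair A B) j, p.1 = x := by
  have := map_wordSpan (AlgHom.fst ℝ 𝕄 𝕄) (letterPair A B) j
  rw [show AlgHom.fst ℝ 𝕄 𝕄 ∘ letterPair A B = A from rfl] at this
  rw [← this] at hx
  exact hx

lemma exists_mem_wordSpan_snd_eq {j : ℕ} {x : 𝕄} (hx : x ∈ wordSpan B j) :
    ∃ p ∈ wordSpan (letterPair A B) j, p.2 = x := by
  have := map_wordSpan (AlgHom.snd ℝ 𝕄 𝕄) (letterPair A B) j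
  rw [show AlgHom.snd ℝ 𝕄 𝕄 ∘ letterPair A B = B from rfl] at this
  rw [← this] at hx
  exact hx

lemma trace_fst_eq_trace_snd
    (hN : ∀ w : List α, w.length < N → (w.map A).prod.trace = (w.map B).prod.trace)
    {x : 𝕄 × 𝕄} (hx : x ∈ wordSpan (letterPair A B) N) : x.1.trace = x.2.trace := by
  induction hx using Submodule.span_induction with
  | zero => simp
  | add x y _ _ hx hy => simp [hx, hy]
  | smul c x _ hx => simp [hx]
  | mem x hx =>
    obtain ⟨w, hw, rfl⟩ := hx
    simpa [prod_map_letterPair] using hN w hw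

lemma star_mem_wordSpan_letterPair (hA : ∀ a, A (σ a) = (A a)ᵀ) (hB : ∀ a, B (σ a) = (B a)ᵀ)
    {j : ℕ} {x : 𝕄 × 𝕄} (hx : x ∈ wordSpan (letterPair A B) j) :
    star x ∈ wordSpan (letterPair A B) j :=
  star_mem_wordSpan (σ := σ) (fun a => by
    ext1 <;> simp [letterPair, hA, hB, star_eq_conjTranspose]) hx

lemma eq_zero_of_trace_mul_star_eq_zero {x : 𝕄} (h : (x * star x).trace = 0) : x = 0 :=
  trace_mul_conjTranspose_self_eq_zero_iff.1 h

/-- A relation of degree at most `j` that holds for `A` also holds for `B`. -/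
lemma eq_zero_of_fst_eq_zero (hA : ∀ a, A (σ a) = (A a)ᵀ) (hB : ∀ a, B (σ a) = (B a)ᵀ)
    (hN : ∀ w : List α, w.length < N → (w.map A).prod.trace = (w.map B).prod.trace)
    {j : ℕ} (hj : 2 * j < N) {x : 𝕄 × 𝕄} (hx : x ∈ wordSpan (letterPair A B) (j + 1))
    (h0 : x.1 = 0) : x = 0 := by
  have h := trace_fst_eq_trace_snd hN
    (mul_mem_wordSpan _ hx (star_mem_wordSpan_letterPair hA hB hx) (by omega))
  refine Prod.ext h0 (eq_zero_of_trace_mul_star_eq_zero ?_)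
  simpa [h0] using h.symm

lemma mem_of_fst_mem (hA : ∀ a, A (σ a) = (A a)ᵀ) (hB : ∀ a, B (σ a) = (B a)ᵀ)
    (hN : ∀ w : List α, w.length < N → (w.map A).prod.trace = (w.map B).prod.trace)
    {j : ℕ} (hj : 2 * j < N) {x : 𝕄 × 𝕄} (hx : x ∈ wordSpan (letterPair A B) (j + 1))
    {p : 𝕄 × 𝕄} (hp : p ∈ wordSpan (letterPair A B) (j + 1)) (h : p.1 = x.1) : x = p :=
  sub_eq_zero.1 (eq_zero_of_fst_eq_zero hA hB hN hj (sub_mem hx hp) (by simp [h]))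

lemma GrowsByAtMostOne.letterPair
    (hA : ∀ a, A (σ a) = (A a)ᵀ) (hB : ∀ a, B (σ a) = (B a)ᵀ)
    (hN : ∀ w : List α, w.length < N → (w.map A).prod.trace = (w.map B).prod.trace)
    {k : ℕ} (hk : 2 * k < N) (h : GrowsByAtMostOne A k) :
    GrowsByAtMostOne (letterPair A B) k := by
  obtain ⟨w, hw, h⟩ := h
  refine ⟨w, hw, fun u hu => ?_⟩
  obtain ⟨_, h1, l, hl, h2⟩ := Submodule.mem_sup.1 (h u hu)
  obtain ⟨c, rfl⟩ := Submodule.mem_span_singleton.1 h1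
  obtain ⟨p, hp, rfl⟩ := exists_mem_wordSpan_fst_eq (B := B) hl
  rw [mem_of_fst_mem hA hB hN hk (prod_mem_wordSpan _ (hu.trans_lt k.lt_succ_self))
    (add_mem (Submodule.smul_mem _ c (prod_mem_wordSpan _ (hw.trans_lt k.lt_succ_self)))
      (wordSpan_mono _ k.le_succ hp)) (by simpa [prod_map_letterPair] using h2)]
  exact add_mem (Submodule.mem_sup_left (Submodule.smul_mem _ c
    (Submodule.mem_span_singleton_self _))) (Submodule.mem_sup_right hp)

/-- When words of length `k` span at most one dimension modulo shorter ones, a long word with a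
nonzero value of `τ` can be rewritten so as to begin with the power `aᵏ`. -/
lemma pow_notMem_wordSpan {R : Type*} [Ring R] [Algebra ℝ R] {C : α → R} {τ : R →ₗ[ℝ] ℝ}
    (hτ : ∀ x ∈ wordSpan C N, τ x = 0) {k : ℕ} (hk : GrowsByAtMostOne C k) (a : α) (r : List α)
    (hr : k + r.length + 1 = N) (s : List α) (i : ℕ) (hs : s.length + i = k)
    (hne : τ ((s ++ List.replicate i a ++ a :: r).map C).prod ≠ 0) :
    C a ^ k ∉ wordSpan C k := by
  induction s generalizing i with
  | nil =>
    intro h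
    obtain rfl : i = k := by simpa using hs
    refine hne (hτ _ ?_)
    have h2 := prod_mem_wordSpan C (w := a :: r) (j := r.length + 2) (by simp)
    simpa using mul_mem_wordSpan C h h2 (l := N) (by omega)
  | cons y s ih =>
    rw [List.length_cons] at hs
    obtain ⟨w, -, hw⟩ := hk
    set u := y :: s ++ List.replicate i a with hu
    set v := s ++ List.replicate (i + 1) a with hv
    have huv : u ++ a :: r = y :: v ++ r := by
      simp [hu, hv, List.replicate_succ']
    have hvk : (v.map C).prod ∉ wordSpan C k := fun h => by
      refine hne (hτ _ ?_)
      have h1 := prod_mem_wordSpan C (w := [y]) (j := 2) (by simp)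
      have h2 := prod_mem_wordSpan C (w := r) (j := r.length + 1) (by simp)
      have h3 := mul_mem_wordSpan C (mul_mem_wordSpan C h1 h (l := k + 1) (by omega)) h2
        (l := N) (by omega)
      rw [huv]
      simpa [mul_assoc] using h3
    obtain ⟨_, h1, l, hl, h2⟩ := Submodule.mem_sup.1 (hw u (by simp [hu]; omega))
    obtain ⟨c, rfl⟩ := Submodule.mem_span_singleton.1 h1
    obtain ⟨_, h3, l', hl', h4⟩ := Submodule.mem_sup.1 (hw v (by simp [hv]; omega))
    obtain ⟨d, rfl⟩ := Submodule.mem_span_singleton.1 h3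
    have hd : d ≠ 0 := by
      rintro rfl
      exact hvk (by rw [← h4]; simpa using hl')
    have hlow : ∀ x ∈ wordSpan C k, τ (x * ((a :: r).map C).prod) = 0 := fun x hx =>
      hτ _ (mul_mem_wordSpan C hx (prod_mem_wordSpan C (w := a :: r) (j := r.length + 2) (by simp))
        (by omega))
    refine ih (i + 1) (by omega) fun h0 => hne ?_
    rw [List.map_append, List.prod_append] at h0 ⊢
    rw [← h4, add_mul, map_add, hlow _ hl', add_zero, smul_mul_assoc, map_smul, smul_eq_mul,
      mul_eq_zero, or_iff_right hd] at h0
    rw [← h2, add_mul, map_add, hlow _ hl, add_zero, smul_mul_assoc, map_smul, h0, smul_zero]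

lemma trace_eq_of_growsByAtMostOne
    (hA : ∀ a, A (σ a) = (A a)ᵀ) (hB : ∀ a, B (σ a) = (B a)ᵀ)
    (hN : ∀ w : List α, w.length < N → (w.map A).prod.trace = (w.map B).prod.trace)
    {k : ℕ} (hk : 2 * k < N) (hnk : n ≤ k) (h : GrowsByAtMostOne A k)
    {w : List α} (hw : w.length = N) : (w.map A).prod.trace = (w.map B).prod.trace := by
  by_contra hne
  obtain ⟨a, r, har⟩ : ∃ a r, w.drop k = a :: r :=
    List.exists_cons_of_length_pos (by rw [List.length_drop]; omega)
  have hlen := congrArg List.length har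
  rw [List.length_drop, List.length_cons] at hlen
  let τ : 𝕄 × 𝕄 →ₗ[ℝ] ℝ :=
    traceLinearMap (Fin n) ℝ ℝ ∘ₗ LinearMap.fst ℝ 𝕄 𝕄 -
      traceLinearMap (Fin n) ℝ ℝ ∘ₗ LinearMap.snd ℝ 𝕄 𝕄
  have hτ : ∀ x ∈ wordSpan (letterPair A B) N, τ x = 0 := fun x hx => by
    simp [τ, trace_fst_eq_trace_snd hN hx]
  refine pow_notMem_wordSpan hτ (h.letterPair hA hB hN hk) a r (by omega) (w.take k) 0
    (by rw [List.length_take]; omega) ?_ ?_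
  · rw [← har, List.replicate_zero, List.append_nil, List.take_append_drop, prod_map_letterPair]
    simpa [τ, sub_eq_zero] using hne
  · obtain ⟨p, hp, hpa⟩ := exists_mem_wordSpan_fst_eq (B := B) (pow_mem_wordSpan A a hnk)
    have hx := prod_mem_wordSpan (letterPair A B) (w := List.replicate k a) (j := k + 1) (by simp)
    rw [List.map_replicate, List.prod_replicate] at hx
    rwa [mem_of_fst_mem hA hB hN hk hx (wordSpan_mono _ k.le_succ hp) hpa]

lemma trace_eq_of_wordSpan_eq_top
    (hA : ∀ a, A (σ a) = (A a)ᵀ) (hB : ∀ a, B (σ a) = (B a)ᵀ)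
    (hN : ∀ w : List α, w.length < N → (w.map A).prod.trace = (w.map B).prod.trace)
    {k : ℕ} (hk : 2 * k + 2 ≤ N) (hAk : wordSpan A (k + 1) = ⊤) (hBk : wordSpan B (k + 1) = ⊤)
    {w : List α} (hw : w.length = N) : (w.map A).prod.trace = (w.map B).prod.trace := by
  have hzero : ∀ x ∈ wordSpan (letterPair A B) (k + 2), x.1 = 0 → x = 0 := fun x hx h0 => by
    obtain ⟨p, hp, hpx⟩ := exists_mem_wordSpan_snd_eq (A := A) (B := B) (j := k + 1) (x := x.2)
      (by simp [hBk])
    have h := trace_fst_eq_trace_snd hN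
      (mul_mem_wordSpan _ hx (star_mem_wordSpan_letterPair hA hB hp) (l := N) (by omega))
    refine Prod.ext h0 (eq_zero_of_trace_mul_star_eq_zero ?_)
    simpa [h0, hpx] using h.symm
  have hu := prod_mem_wordSpan (letterPair A B) (w := w.take (k + 1)) (j := k + 2)
    (by rw [List.length_take]; omega)
  obtain ⟨p, hp, hpu⟩ := exists_mem_wordSpan_fst_eq (A := A) (B := B) (j := k + 1)
    (x := ((w.take (k + 1)).map (letterPair A B)).prod.1) (by simp [hAk])
  have hup := sub_eq_zero.1 (hzero _ (sub_mem hu (wordSpan_mono _ (k + 1).le_succ hp))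
    (by simp [hpu]))
  have hv := prod_mem_wordSpan (letterPair A B) (w := w.drop (k + 1)) (j := N - k)
    (by rw [List.length_drop]; omega)
  have h := trace_fst_eq_trace_snd hN (mul_mem_wordSpan _ hp hv (l := N) (by omega))
  rw [← hup, ← List.prod_append, ← List.map_append, List.take_append_drop,
    prod_map_letterPair] at h
  exact h

/-- Equality of traces on words of length at most `n ^ 2` implies equality on all words. -/
theorem trace_eq_of_trace_eq_of_length_le [Nonempty α] (hn : 1 ≤ n)
    (hA : ∀ a, A (σ a) = (A a)ᵀ) (hB : ∀ a, B (σ a) = (B a)ᵀ)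
    (h : ∀ w : List α, w.length ≤ n ^ 2 → (w.map A).prod.trace = (w.map B).prod.trace)
    (w : List α) : (w.map A).prod.trace = (w.map B).prod.trace := by
  induction hN : w.length using Nat.strong_induction_on generalizing w with
  | _ N ih =>
  rcases le_or_gt N (n ^ 2) with hle | hlt
  · exact h w (hN ▸ hle)
  replace ih : ∀ w : List α, w.length < N → (w.map A).prod.trace = (w.map B).prod.trace :=
    fun w hw => ih _ hw w rfl
  set k := n ^ 2 / 2 with hk
  have hnk : 1 ≤ k → n ≤ k := fun h1 => by
    rw [hk, Nat.le_div_iff_mul_le two_pos] at h1 ⊢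
    nlinarith
  by_cases hgA : ∃ j, 1 ≤ j ∧ j ≤ k ∧ GrowsByAtMostOne A j
  · obtain ⟨j, hj, hjk, hg⟩ := hgA
    exact trace_eq_of_growsByAtMostOne hA hB ih (by omega) (hnk (hj.trans hjk)) (hg.mono hj hjk) hN
  by_cases hgB : ∃ j, 1 ≤ j ∧ j ≤ k ∧ GrowsByAtMostOne B j
  · obtain ⟨j, hj, hjk, hg⟩ := hgB
    exact (trace_eq_of_growsByAtMostOne hB hA (fun w hw => (ih w hw).symm) (by omega)
      (hnk (hj.trans hjk)) (hg.mono hj hjk) hN).symm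
  have : Nonempty (Fin n) := ⟨⟨0, hn⟩⟩
  have hM : Module.finrank ℝ 𝕄 = n ^ 2 := by
    rw [Module.finrank_matrix]
    simp [sq]
  have htop : ∀ C : α → 𝕄, (¬ ∃ j, 1 ≤ j ∧ j ≤ k ∧ GrowsByAtMostOne C j) →
      2 * k + 1 = n ^ 2 ∧ wordSpan C (k + 1) = ⊤ := fun C hC => by
    have h1 := two_mul_add_one_le_finrank_wordSpan (C := C) (k := k)
      fun j hj hjk hg => hC ⟨j, hj, hjk, hg⟩
    have h2 := (wordSpan C (k + 1)).finrank_le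
    exact ⟨by omega, Submodule.eq_top_of_finrank_eq (by omega)⟩
  obtain ⟨h1, hAk⟩ := htop A hgA
  exact trace_eq_of_wordSpan_eq_top hA hB ih (by omega) hAk (htop B hgB).2 hN

end TracePairs

section Specht

variable {α : Type*} {n : ℕ} {A B : α → Matrix (Fin n) (Fin n) ℝ} {σ : α → α}

local notation "𝕄" => Matrix (Fin n) (Fin n) ℝ

/-- The representation of the free algebra on Euclidean space sending the letters to `A`. -/
noncomputable def wordRep (A : α → Matrix (Fin n) (Fin n) ℝ) :
    MonoidAlgebra ℝ (FreeMonoid α) →ₐ[ℝ] Module.End ℝ (EuclideanSpace ℝ (Fin n)) :=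
  (toLpLinAlgEquiv 2).toAlgHom.comp (MonoidAlgebra.lift ℝ 𝕄 (FreeMonoid α) (FreeMonoid.lift A))

lemma wordRep_of (w : FreeMonoid α) :
    wordRep A (MonoidAlgebra.of ℝ _ w) = toEuclideanLin (w.toList.map A).prod := by
  rw [wordRep, AlgHom.comp_apply, MonoidAlgebra.lift_of, FreeMonoid.lift_apply]
  rfl

lemma inner_toEuclideanLin (M : 𝕄) (x y : EuclideanSpace ℝ (Fin n)) :
    inner ℝ (toEuclideanLin M x) y = inner ℝ x (toEuclideanLin Mᵀ y) := by
  rw [← conjTranspose_eq_transpose_of_trivial, toEuclideanLin_conjTranspose_eq_adjoint,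
    LinearMap.adjoint_inner_right]

lemma trace_toEuclideanLin (M : 𝕄) : LinearMap.trace ℝ _ (toEuclideanLin M) = M.trace := by
  rw [toEuclideanLin, toLpLin_eq_toLin, trace_toLin_eq]

lemma exists_wordRep_adjoint (hA : ∀ a, A (σ a) = (A a)ᵀ) (hB : ∀ a, B (σ a) = (B a)ᵀ)
    (r : MonoidAlgebra ℝ (FreeMonoid α)) : ∃ s,
      (∀ x y, inner ℝ (wordRep A r x) y = inner ℝ x (wordRep A s y)) ∧
      ∀ x y, inner ℝ (wordRep B r x) y = inner ℝ x (wordRep B s y) := by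
  induction r using MonoidAlgebra.induction_on with
  | of w =>
    have key : ∀ C : α → 𝕄, (∀ a, C (σ a) = (C a)ᵀ) →
        ((w.toList.reverse.map σ).map C).prod = (w.toList.map C).prodᵀ := fun C hC => by
      induction w.toList with
      | nil => simp
      | cons a w ih =>
        rw [List.reverse_cons, List.map_append, List.map_append, List.prod_append, ih]
        simp [hC]
    refine ⟨MonoidAlgebra.of ℝ _ (FreeMonoid.ofList (w.toList.reverse.map σ)), ?_, ?_⟩
    · intro x y
      rw [wordRep_of, wordRep_of, inner_toEuclideanLin, FreeMonoid.toList_ofList, key A hA]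
    · intro x y
      rw [wordRep_of, wordRep_of, inner_toEuclideanLin, FreeMonoid.toList_ofList, key B hB]
  | add r r' h h' =>
    obtain ⟨s, h1, h2⟩ := h
    obtain ⟨s', h1', h2'⟩ := h'
    exact ⟨s + s', fun x y => by simp [inner_add_left, inner_add_right, h1, h1'],
      fun x y => by simp [inner_add_left, inner_add_right, h2, h2']⟩
  | smul c r h =>
    obtain ⟨s, h1, h2⟩ := h
    exact ⟨c • s, fun x y => by simp [inner_smul_left, inner_smul_right, h1],
      fun x y => by simp [inner_smul_left, inner_smul_right, h2]⟩

lemma trace_wordRep_eq (h : ∀ w : List α, (w.map A).prod.trace = (w.map B).prod.trace)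
    (r : MonoidAlgebra ℝ (FreeMonoid α)) :
    LinearMap.trace ℝ _ (wordRep A r) = LinearMap.trace ℝ _ (wordRep B r) := by
  induction r using MonoidAlgebra.induction_on with
  | of w => rw [wordRep_of, wordRep_of, trace_toEuclideanLin, trace_toEuclideanLin, h]
  | add r r' h h' => rw [map_add, map_add, map_add, map_add, h, h']
  | smul c r h => rw [map_smul, map_smul, map_smul, map_smul, h]

/-- Specht theorem: self-adjoint families of real matrices with the same word traces are
orthogonally similar. -/
theorem exists_orthogonal_of_trace_eq
    (hA : ∀ a, A (σ a) = (A a)ᵀ) (hB : ∀ a, B (σ a) = (B a)ᵀ)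
    (h : ∀ w : List α, (w.map A).prod.trace = (w.map B).prod.trace) :
    ∃ U : 𝕄, Uᵀ * U = 1 ∧ ∀ a, Uᵀ * A a * U = B a := by
  choose st hstA hstB using exists_wordRep_adjoint hA hB
  obtain ⟨Φ, hΦ⟩ := exists_linearIsometry_intertwining (wordRep A) (wordRep B) st hstA hstB
    (trace_wordRep_eq h)
  obtain ⟨M, hM⟩ := toEuclideanLin.surjective Φ.toLinearMap
  have hΦM : ∀ x, Φ x = toEuclideanLin M x := fun x => by rw [hM]; rfl
  have hMM : Mᵀ * M = 1 := by
    refine toEuclideanLin.injective (LinearMap.ext fun x => ext_inner_left ℝ fun y => ?_)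
    rw [toLpLin_mul_same, LinearMap.comp_apply, ← inner_toEuclideanLin, ← hΦM, ← hΦM,
      Φ.inner_map_map]
    simp
  have hMA : ∀ a, M * A a = B a * M := fun a => by
    refine toEuclideanLin.injective (LinearMap.ext fun x => ?_)
    have h1 := hΦ (MonoidAlgebra.of ℝ _ (FreeMonoid.of a)) x
    rw [wordRep_of, wordRep_of, hΦM, hΦM] at h1
    rw [toLpLin_mul_same, toLpLin_mul_same]
    simpa using h1
  have hMM' : M * Mᵀ = 1 := mul_eq_one_comm.1 hMM
  refine ⟨Mᵀ, by rwa [transpose_transpose], fun a => ?_⟩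
  rw [transpose_transpose, hMA, mul_assoc, hMM', mul_one]

lemma prod_map_conj {U : 𝕄} (hU : Uᵀ * U = 1) (h : ∀ a, Uᵀ * A a * U = B a) (w : List α) :
    (w.map B).prod = Uᵀ * (w.map A).prod * U := by
  have hU' : U * Uᵀ = 1 := mul_eq_one_comm.1 hU
  induction w with
  | nil => simp [hU]
  | cons a w ih =>
    rw [List.map_cons, List.prod_cons, ih, ← h, List.map_cons, List.prod_cons]
    simp only [mul_assoc]
    rw [← mul_assoc U, hU', one_mul]

end Specht

/-- Specht property for ℝ with bound `n²`: two `m`-tuples of `n × n` real matrices are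
simultaneously orthogonally similar iff all traces of words of length at most `n²` in the
matrices and their transposes agree. A word in `2m` non-commuting letters is a nonempty list
over the alphabet `Fin m ⊕ Fin m`, where the letter `Sum.inl i` is evaluated at the `i`-th
matrix and `Sum.inr i` at its transpose. -/
theorem specht_real (n m : ℕ) (hn : 1 ≤ n) (hm : 1 ≤ m)
    (A B : Fin m → Matrix (Fin n) (Fin n) ℝ) :
    (∃ U : Matrix (Fin n) (Fin n) ℝ, Uᵀ * U = 1 ∧ ∀ i : Fin m, Uᵀ * A i * U = B i) ↔
      (∀ w : List (Fin m ⊕ Fin m), w ≠ [] → w.length ≤ n ^ 2 →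
        ((w.map (Sum.elim A (fun i => (A i)ᵀ))).prod).trace =
          ((w.map (Sum.elim B (fun i => (B i)ᵀ))).prod).trace) := by
  constructor
  · rintro ⟨U, hU, h⟩ w - -
    have h' : ∀ a, Uᵀ * Sum.elim A (fun i => (A i)ᵀ) a * U = Sum.elim B (fun i => (B i)ᵀ) a := by
      rintro (i | i)
      · exact h i
      · simp [← h i, mul_assoc]
    rw [prod_map_conj hU h', trace_mul_comm, ← mul_assoc, mul_eq_one_comm.1 hU, one_mul]
  · intro h
    have : Nonempty (Fin m ⊕ Fin m) := ⟨Sum.inl ⟨0, hm⟩⟩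
    have hswap : ∀ (C : Fin m → Matrix (Fin n) (Fin n) ℝ) (a : Fin m ⊕ Fin m),
        Sum.elim C (fun i => (C i)ᵀ) a.swap = (Sum.elim C (fun i => (C i)ᵀ) a)ᵀ := by
      rintro C (i | i) <;> simp
    obtain ⟨U, hU, hUA⟩ := exists_orthogonal_of_trace_eq (hswap A) (hswap B)
      (trace_eq_of_trace_eq_of_length_le hn (hswap A) (hswap B) fun w hw => by
        rcases eq_or_ne w [] with rfl | hne
        · simp
        · exact h w hne hw)
    exact ⟨U, hU, fun i => hUA (Sum.inl i)⟩
end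

section
/- Let n, m ≥ 1 and let A = (A_1,…,A_m) and B = (B_1,…,B_m) be m-tuples of n×n complex matrices. Then there exists a unitary matrix U ∈ U(n) with U* A_i U = B_i for all i = 1,…,m if and only if for every nonempty word ω of length at most n² in 2m non-commuting letters one has tr(ω(A_1,…,A_m, A_1*,…,A_m*)) = tr(ω(B_1,…,B_m, B_1*,…,B_m*)), where ω(X_1,…,X_{2m}) denotes the product of matrices obtained by substituting X_j for the j-th letter of ω. -/
open Matrix

universe u

section ComplexOrder

open scoped ComplexOrder

theorem Matrix.PosDef.exists_isHermitian_mul_mul_eq_one {n : Type*} [Fintype n] [DecidableEq n]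
    {P : Matrix n n ℂ} (hP : P.PosDef) :
    ∃ Q : Matrix n n ℂ, Q.IsHermitian ∧ Q * P * Q = 1 ∧ ∀ X, Commute P X → Commute Q X := by
  have hsa : IsSelfAdjoint P := hP.isHermitian
  have hpos : ∀ x ∈ spectrum ℝ P, 0 < x := by
    intro x hx
    rw [hP.isHermitian.spectrum_real_eq_range_eigenvalues] at hx
    obtain ⟨i, rfl⟩ := hx
    exact hP.eigenvalues_pos i
  refine ⟨cfc (fun x : ℝ => (√x)⁻¹) P, cfc_predicate _ P, ?_, fun X hX => hX.cfc_real _⟩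
  have hc (f : ℝ → ℝ) : ContinuousOn f (spectrum ℝ P) :=
    (Matrix.finite_real_spectrum (A := P)).continuousOn f
  nth_rewrite 2 [← cfc_id' ℝ P]
  rw [← cfc_mul _ _ P (hc _) (hc _), ← cfc_mul _ _ P (hc _) (hc _), ← cfc_one ℝ P]
  refine cfc_congr fun x hx => ?_
  have h := Real.sqrt_pos.2 (hpos x hx)
  have h2 := Real.mul_self_sqrt (hpos x hx).le
  simp only [Pi.one_apply]
  field_simp
  linarith

/-- Similar families of matrices closed under conjugate transposition are unitarily similar. -/
theorem exists_unitary_of_isUnit_intertwiner {n L : Type*} [Fintype n] [DecidableEq n]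
    (A B : L → Matrix n n ℂ) (S : Matrix n n ℂ) (hS : IsUnit S)
    (h : ∀ l, S * A l = B l * S) (h' : ∀ l, S * (A l)ᴴ = (B l)ᴴ * S) :
    ∃ U : Matrix n n ℂ, Uᴴ * U = 1 ∧ ∀ l, Uᴴ * A l * U = B l := by
  have hP : (Sᴴ * S).PosDef := by
    refine Matrix.PosDef.conjTranspose_mul_self S ?_
    exact Matrix.mulVec_injective_iff_isUnit.2 hS
  obtain ⟨Q, hQ, hQP, hcomm⟩ := hP.exists_isHermitian_mul_mul_eq_one
  have hU : (S * Q)ᴴ * (S * Q) = 1 := by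
    rw [conjTranspose_mul, hQ.eq, ← hQP]
    simp only [mul_assoc]
  have hU' := mul_eq_one_comm.1 hU
  refine ⟨(S * Q)ᴴ, by rwa [conjTranspose_conjTranspose], fun l => ?_⟩
  have hPA : Commute (Sᴴ * S) (A l) := by
    have := congrArg conjTranspose (h' l)
    simp only [conjTranspose_mul, conjTranspose_conjTranspose] at this
    rw [Commute, SemiconjBy, mul_assoc, h l, ← mul_assoc, ← this, mul_assoc]
  rw [conjTranspose_conjTranspose, mul_assoc S, (hcomm _ hPA).eq, ← mul_assoc S, h l,
    mul_assoc (B l), mul_assoc (B l), hU', mul_one]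

section SemisimpleTrace

variable {R M N : Type*} [Ring R] [AddCommGroup M] [Module R M] [AddCommGroup N] [Module R N]

theorem IsSemisimpleModule.prod [IsSemisimpleModule R M] [IsSemisimpleModule R N] :
    IsSemisimpleModule R (M × N) := by
  refine isSemisimpleModule_of_isSemisimpleModule_submodule'
    (p := fun b : Bool => if b then LinearMap.range (LinearMap.inl R M N)
      else LinearMap.range (LinearMap.inr R M N)) ?_ ?_
  · rintro (_ | _)
    · exact .range _
    · exact .range _
  · rw [iSup_bool_eq]
    exact LinearMap.sup_range_inl_inr

theorem exists_smul_eq_and_smul_eq_zero_of_hom_eq_zero [IsSemisimpleModule R M]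
    [IsSemisimpleModule R N] (hMN : ∀ f : M →ₗ[R] N, f = 0) (hNM : ∀ f : N →ₗ[R] M, f = 0)
    {ι κ : Type*} [Finite ι] [Finite κ] (x : ι → M) (y : κ → N) :
    ∃ r : R, (∀ i, r • x i = x i) ∧ ∀ k, r • y k = 0 := by
  classical
  cases nonempty_fintype ι
  cases nonempty_fintype κ
  have : IsSemisimpleModule R ((ι → M) × (κ → N)) := .prod
  obtain ⟨q, hq⟩ := exists_isCompl (Submodule.span R {((x, y) : (ι → M) × (κ → N))})
  set p := Submodule.span R {((x, y) : (ι → M) × (κ → N))} with hp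
  let π := p.subtype ∘ₗ p.projectionOnto q hq
  have h1 : π (x, y) = (x, y) := by
    have := Submodule.projectionOnto_apply_left hq ⟨(x, y), Submodule.mem_span_singleton_self _⟩
    simpa [π] using congrArg Subtype.val this
  have hzMN (f : (ι → M) →ₗ[R] (κ → N)) : f = 0 := by
    ext i m k
    simpa using LinearMap.congr_fun
      (hMN (LinearMap.proj k ∘ₗ f ∘ₗ LinearMap.single R (fun _ => M) i)) m
  have hzNM (f : (κ → N) →ₗ[R] (ι → M)) : f = 0 := by
    ext i m k
    simpa using LinearMap.congr_fun
      (hNM (LinearMap.proj k ∘ₗ f ∘ₗ LinearMap.single R (fun _ => N) i)) m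
  have h2 : (π (x, 0)).2 = 0 :=
    LinearMap.congr_fun (hzMN (LinearMap.snd R _ _ ∘ₗ π ∘ₗ LinearMap.inl R _ _)) x
  have h3 : (π (0, y)).1 = 0 :=
    LinearMap.congr_fun (hzNM (LinearMap.fst R _ _ ∘ₗ π ∘ₗ LinearMap.inr R _ _)) y
  have h4 : π (x, 0) + π (0, y) = (x, y) := by rw [← map_add]; simpa using h1
  have h5 : π (x, 0) = (x, 0) := by
    ext1
    · simpa [h3] using congrArg Prod.fst h4
    · exact h2
  have h6 : ((x, 0) : (ι → M) × (κ → N)) ∈ p := by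
    rw [← h5]; exact Subtype.property _
  obtain ⟨r, hr⟩ := Submodule.mem_span_singleton.1 h6
  exact ⟨r, fun i => congrFun (congrArg Prod.fst hr) i, fun k => congrFun (congrArg Prod.snd hr) k⟩

theorem exists_linearEquiv_prod_of_linearMap [IsSemisimpleModule R M]
    [IsSemisimpleModule R N] (f : M →ₗ[R] N) :
    ∃ q : Submodule R N, Nonempty (M ≃ₗ[R] LinearMap.range f × LinearMap.ker f) ∧
      Nonempty (N ≃ₗ[R] LinearMap.range f × q) := by
  obtain ⟨c, hc⟩ := exists_isCompl (LinearMap.ker f)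
  obtain ⟨q, hq⟩ := exists_isCompl (LinearMap.range f)
  exact ⟨q, ⟨(Submodule.prodEquivOfIsCompl _ _ hc.symm).symm.trans
    (((Submodule.quotientEquivOfIsCompl _ _ hc).symm.trans f.quotKerEquivRange).prodCongr
      (LinearEquiv.refl R _))⟩, ⟨(Submodule.prodEquivOfIsCompl _ _ hq).symm⟩⟩

theorem linearMap_eq_zero_of_forall_linearMap_eq_zero [IsSemisimpleModule R M]
    [IsSemisimpleModule R N] (h : ∀ f : M →ₗ[R] N, f = 0) (g : N →ₗ[R] M) : g = 0 := by
  obtain ⟨q, ⟨e⟩, ⟨e'⟩⟩ := exists_linearEquiv_prod_of_linearMap g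
  have h0 := h (e.symm.toLinearMap ∘ₗ LinearMap.inl R _ _ ∘ₗ LinearMap.fst R _ _ ∘ₗ
    e'.toLinearMap)
  ext x
  have hx := LinearMap.congr_fun h0 (e'.symm (⟨g x, x, rfl⟩, 0))
  simpa using congrArg Subtype.val (show (⟨g x, x, rfl⟩ : LinearMap.range g) = 0 by simpa using hx)

end SemisimpleTrace

section TraceLsmul

variable {K R : Type*} [Field K] [Ring R] [Algebra K R]

theorem trace_lsmul_eq_of_linearEquiv {M N : Type*} [AddCommGroup M] [Module K M] [Module R M]
    [IsScalarTower K R M] [AddCommGroup N] [Module K N] [Module R N] [IsScalarTower K R N]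
    (e : M ≃ₗ[R] N) (r : R) :
    LinearMap.trace K M (Algebra.lsmul K K M r) = LinearMap.trace K N (Algebra.lsmul K K N r) := by
  rw [← LinearMap.trace_conj' _ (e.restrictScalars K)]
  congr 1
  ext x
  simp [LinearEquiv.conj_apply]

theorem trace_lsmul_prod {M N : Type*} [AddCommGroup M] [Module K M] [Module R M]
    [IsScalarTower K R M] [AddCommGroup N] [Module K N] [Module R N] [IsScalarTower K R N]
    [FiniteDimensional K M] [FiniteDimensional K N] (r : R) :
    LinearMap.trace K (M × N) (Algebra.lsmul K K (M × N) r) =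
      LinearMap.trace K M (Algebra.lsmul K K M r) +
        LinearMap.trace K N (Algebra.lsmul K K N r) := by
  rw [← LinearMap.trace_prodMap']
  rfl

theorem subsingleton_of_trace_lsmul_eq [CharZero K] {M N : Type*}
    [AddCommGroup M] [Module K M] [Module R M] [IsScalarTower K R M]
    [AddCommGroup N] [Module K N] [Module R N] [IsScalarTower K R N]
    [FiniteDimensional K M] [FiniteDimensional K N] [IsSemisimpleModule R M]
    [IsSemisimpleModule R N] (hMN : ∀ f : M →ₗ[R] N, f = 0) (hNM : ∀ f : N →ₗ[R] M, f = 0)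
    (h : ∀ r : R, LinearMap.trace K M (Algebra.lsmul K K M r) =
      LinearMap.trace K N (Algebra.lsmul K K N r)) :
    Subsingleton M := by
  let b := Module.finBasis K M
  let c := Module.finBasis K N
  obtain ⟨r, hb, hc⟩ := exists_smul_eq_and_smul_eq_zero_of_hom_eq_zero hMN hNM b c
  have h1 : (Algebra.lsmul K K M r : M →ₗ[K] M) = 1 := b.ext fun i => by simpa using hb i
  have h2 : (Algebra.lsmul K K N r : N →ₗ[K] N) = 0 := c.ext fun i => by simpa using hc i
  have := h r
  rw [h1, h2, map_zero, LinearMap.trace_one, Nat.cast_eq_zero] at this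
  exact Module.finrank_zero_iff.1 this

/-- Finite-dimensional semisimple modules in characteristic zero are determined by their
characters. -/
theorem nonempty_linearEquiv_of_trace_lsmul_eq [CharZero K] (d : ℕ) :
    ∀ {M N : Type*} [AddCommGroup M] [Module K M] [Module R M]
    [IsScalarTower K R M] [AddCommGroup N] [Module K N] [Module R N] [IsScalarTower K R N]
    [FiniteDimensional K M] [FiniteDimensional K N] [IsSemisimpleModule R M]
    [IsSemisimpleModule R N] (_ : Module.finrank K M = d)
    (_ : ∀ r : R, LinearMap.trace K M (Algebra.lsmul K K M r) =
      LinearMap.trace K N (Algebra.lsmul K K N r)), Nonempty (M ≃ₗ[R] N) := by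
  induction d using Nat.strong_induction_on with
  | _ d ih =>
    intro M N _ _ _ _ _ _ _ _ _ _ _ _ hd h
    by_cases hMN : ∀ f : M →ₗ[R] N, f = 0
    · have hNM := linearMap_eq_zero_of_forall_linearMap_eq_zero hMN
      have := subsingleton_of_trace_lsmul_eq hMN hNM h
      have := subsingleton_of_trace_lsmul_eq hNM hMN fun r => (h r).symm
      exact ⟨0⟩
    · push Not at hMN
      obtain ⟨f, hf⟩ := hMN
      obtain ⟨q, ⟨e⟩, ⟨e'⟩⟩ := exists_linearEquiv_prod_of_linearMap f
      have : Nontrivial (LinearMap.range f) := by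
        rwa [Submodule.nontrivial_iff_ne_bot, ne_eq, LinearMap.range_eq_bot]
      have : FiniteDimensional K q := inferInstanceAs (FiniteDimensional K (q.restrictScalars K))
      have : FiniteDimensional K (LinearMap.range f) :=
        inferInstanceAs (FiniteDimensional K ((LinearMap.range f).restrictScalars K))
      have : FiniteDimensional K (LinearMap.ker f) :=
        inferInstanceAs (FiniteDimensional K ((LinearMap.ker f).restrictScalars K))
      have hlt : Module.finrank K (LinearMap.ker f) < d := by
        have h1 := (e.restrictScalars K).finrank_eq
        rw [Module.finrank_prod] at h1
        have := Module.finrank_pos (R := K) (M := LinearMap.range f)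
        omega
      obtain ⟨g⟩ := ih _ hlt (M := LinearMap.ker f) (N := q) rfl fun r => by
        have := h r
        rwa [trace_lsmul_eq_of_linearEquiv e, trace_lsmul_eq_of_linearEquiv e',
          trace_lsmul_prod, trace_lsmul_prod, add_right_inj] at this
      exact ⟨e.trans (((LinearEquiv.refl R _).prodCongr g).trans e'.symm)⟩

end TraceLsmul

/-- The representation of the free monoid on `L` sending a word to its value at the matrices `X`. -/
noncomputable def Matrix.wordRepresentation {n L : Type*} [Fintype n] [DecidableEq n]
    (X : L → Matrix n n ℂ) : Representation ℂ (FreeMonoid L) (EuclideanSpace ℂ n) :=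
  FreeMonoid.lift fun l => Matrix.toEuclideanLin (X l)

theorem Matrix.wordRepresentation_apply {n L : Type*} [Fintype n] [DecidableEq n]
    (X : L → Matrix n n ℂ) (w : FreeMonoid L) :
    wordRepresentation X w = Matrix.toEuclideanLin ((w.toList.map X).prod) := by
  induction w using FreeMonoid.inductionOn' with
  | one => simp [Matrix.toLpLin_one]; rfl
  | of_mul l w ih =>
    rw [map_mul, ih]
    simp only [wordRepresentation, FreeMonoid.lift_eval_of, FreeMonoid.toList_mul,
      FreeMonoid.toList_of, List.map_append, List.prod_append, List.map_singleton,
      List.prod_singleton]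
    rw [Matrix.toLpLin_mul_same]; rfl

theorem Matrix.isSemisimpleModule_wordRepresentation {n L : Type*} [Fintype n] [DecidableEq n]
    (X : L → Matrix n n ℂ) (hX : ∀ l, ∃ l', X l' = (X l)ᴴ) :
    IsSemisimpleModule (MonoidAlgebra ℂ (FreeMonoid L)) (wordRepresentation X).asModule := by
  rw [isSemisimpleModule_iff, ← (wordRepresentation X).mapSubmodule.complementedLattice_iff]
  have hmem {p : Submodule ℂ (EuclideanSpace ℂ n)} : p ∈ (wordRepresentation X).invtSubmodule ↔
      ∀ l, ∀ v ∈ p, Matrix.toEuclideanLin (X l) v ∈ p := by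
    rw [Representation.mem_invtSubmodule]
    constructor
    · intro h l v hv
      have := h (FreeMonoid.of l) hv
      simpa [wordRepresentation] using this
    · intro h w
      induction w using FreeMonoid.inductionOn' with
      | one => intro v hv; simpa using hv
      | of_mul l w ih =>
        intro v hv
        have := h l _ (ih hv)
        simpa [wordRepresentation] using this
  refine ⟨fun ⟨p, hp⟩ => ⟨⟨pᗮ, ?_⟩, ?_⟩⟩
  · rw [hmem] at hp ⊢
    intro l v hv u hu
    obtain ⟨l', hl'⟩ := hX l
    rw [← LinearMap.adjoint_inner_left, ← Matrix.toEuclideanLin_conjTranspose_eq_adjoint, ← hl']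
    exact hv _ (hp l' u hu)
  · have hc := Submodule.isCompl_orthogonal (K := p)
    refine ⟨?_, ?_⟩
    · rw [disjoint_iff]
      exact Subtype.ext hc.inf_eq_bot
    · rw [codisjoint_iff]
      exact Subtype.ext hc.sup_eq_top

theorem Matrix.exists_intertwiner_of_trace_word_eq {n L : Type*} [Fintype n] [DecidableEq n]
    (A B : L → Matrix n n ℂ) (hA : ∀ l, ∃ l', A l' = (A l)ᴴ) (hB : ∀ l, ∃ l', B l' = (B l)ᴴ)
    (h : ∀ w : List L, (w.map A).prod.trace = (w.map B).prod.trace) :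
    ∃ S : Matrix n n ℂ, IsUnit S ∧ ∀ l, S * A l = B l * S := by
  have := isSemisimpleModule_wordRepresentation A hA
  have := isSemisimpleModule_wordRepresentation B hB
  have htr : ∀ r : MonoidAlgebra ℂ (FreeMonoid L),
      LinearMap.trace ℂ _ (Algebra.lsmul ℂ ℂ (wordRepresentation A).asModule r) =
      LinearMap.trace ℂ _ (Algebra.lsmul ℂ ℂ (wordRepresentation B).asModule r) := by
    intro r
    induction r using MonoidAlgebra.induction_on with
    | of w =>
      have key (X : L → Matrix n n ℂ) : LinearMap.trace ℂ _ (Algebra.lsmul ℂ ℂ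
          (wordRepresentation X).asModule (MonoidAlgebra.of ℂ _ w)) =
          (w.toList.map X).prod.trace := by
        rw [← Matrix.trace_toLin_eq _ (EuclideanSpace.basisFun n ℂ).toBasis,
          ← LinearMap.trace_conj' _ (wordRepresentation X).asModuleEquiv]
        rw [← Matrix.toEuclideanLin_eq_toLin_orthonormal, ← wordRepresentation_apply]
        congr 1
        ext1 v
        rw [LinearEquiv.conj_apply_apply]
        change (wordRepresentation X).asModuleEquiv (MonoidAlgebra.of ℂ _ w • _) = _
        rw [Representation.asModuleEquiv_map_smul, Representation.asAlgebraHom_of,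
          LinearEquiv.apply_symm_apply]
      rw [key, key, h]
    | add x y hx hy => simp only [map_add, hx, hy]
    | smul c x hx => simp only [map_smul, hx]
  obtain ⟨e⟩ : Nonempty ((wordRepresentation A).asModule ≃ₗ[MonoidAlgebra ℂ (FreeMonoid L)]
    (wordRepresentation B).asModule) :=
    nonempty_linearEquiv_of_trace_lsmul_eq _ rfl htr
  let f : EuclideanSpace ℂ n ≃ₗ[ℂ] EuclideanSpace ℂ n :=
    (wordRepresentation A).asModuleEquiv.symm.trans
      ((e.restrictScalars ℂ).trans (wordRepresentation B).asModuleEquiv)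
  have hf : ∀ l v, f (Matrix.toEuclideanLin (A l) v) = Matrix.toEuclideanLin (B l) (f v) := by
    intro l v
    have key (X : L → Matrix n n ℂ) (v : (wordRepresentation X).asModule) :
        (wordRepresentation X).asModuleEquiv (MonoidAlgebra.of ℂ _ (FreeMonoid.of l) • v) =
          Matrix.toEuclideanLin (X l) ((wordRepresentation X).asModuleEquiv v) := by
      rw [Representation.asModuleEquiv_map_smul, Representation.asAlgebraHom_of]
      simp [wordRepresentation]
    have h1 := key B (e ((wordRepresentation A).asModuleEquiv.symm v))
    rw [← map_smul] at h1
    have h2 := key A ((wordRepresentation A).asModuleEquiv.symm v)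
    rw [LinearEquiv.apply_symm_apply, ← LinearEquiv.eq_symm_apply] at h2
    rw [h2] at h1
    exact h1
  have hS := (Matrix.toEuclideanLin (m := n) (n := n) (𝕜 := ℂ)).apply_symm_apply f.toLinearMap
  set S := (Matrix.toEuclideanLin (m := n) (n := n) (𝕜 := ℂ)).symm f.toLinearMap
  refine ⟨S, ?_, fun l => Matrix.toEuclideanLin.injective ?_⟩
  · rw [← Matrix.mulVec_injective_iff_isUnit]
    intro v w hvw
    have h1 : Matrix.toEuclideanLin S (WithLp.toLp 2 v) =
        Matrix.toEuclideanLin S (WithLp.toLp 2 w) := by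
      simpa using hvw
    rw [hS] at h1
    simpa using f.injective h1
  · rw [Matrix.toLpLin_mul_same, Matrix.toLpLin_mul_same, hS]
    ext1 v
    exact hf l v

/-- The trace monomial of a permutation `σ`: the product over the cycles `(i₁ i₂ … iₖ)` of `σ` of
`tr (X i₁ * X i₂ * ⋯ * X iₖ)`. -/
def Matrix.permTrace {ι n R : Type*} [Fintype ι] [Fintype n] [DecidableEq ι] [CommRing R]
    (σ : Equiv.Perm ι) (X : ι → Matrix n n R) : R :=
  ∑ f : ι → n, ∏ i, X i (f i) (f (σ i))

section PermTrace

variable {n R : Type*} [Fintype n] [CommRing R]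

theorem Matrix.prod_ofFn_apply [DecidableEq n] {N : ℕ} (X : Fin (N + 1) → Matrix n n R) (a b : n) :
    (List.ofFn X).prod a b = ∑ g : Fin N → n, ∏ i, X i ((Fin.cons a g : Fin (N + 1) → n) i)
      ((Fin.snoc g b : Fin (N + 1) → n) i) := by
  induction N generalizing a with
  | zero => simp [Fin.snoc]
  | succ N ih =>
    rw [List.ofFn_succ, List.prod_cons, Matrix.mul_apply,
      ← (Fin.consEquiv fun _ : Fin (N + 1) => n).sum_comp, Fintype.sum_prod_type]
    refine Finset.sum_congr rfl fun c _ => ?_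
    rw [ih, Finset.mul_sum]
    refine Finset.sum_congr rfl fun g _ => ?_
    rw [Fin.prod_univ_succ (n := N + 1)]
    change _ = X 0 a ((Fin.snoc (Fin.cons c g : Fin (N + 1) → n) b : Fin (N + 2) → n) 0) *
      ∏ i : Fin (N + 1), X i.succ ((Fin.cons a (Fin.cons c g : Fin (N + 1) → n) : Fin (N + 2) → n)
        i.succ) ((Fin.snoc (Fin.cons c g : Fin (N + 1) → n) b : Fin (N + 2) → n) i.succ)
    simp only [← Fin.cons_snoc_eq_snoc_cons, Fin.cons_zero, Fin.cons_succ]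

theorem Matrix.permTrace_finRotate [DecidableEq n] {N : ℕ} (X : Fin (N + 1) → Matrix n n R) :
    permTrace (finRotate (N + 1)) X = (List.ofFn X).prod.trace := by
  rw [permTrace, ← (Fin.consEquiv fun _ : Fin (N + 1) => n).sum_comp, Fintype.sum_prod_type]
  refine Finset.sum_congr rfl fun a _ => ?_
  rw [diag_apply, prod_ofFn_apply]
  refine Finset.sum_congr rfl fun g _ => ?_
  rw [Fin.snoc_eq_cons_rotate]
  rfl

variable {ι κ : Type*} [Fintype ι] [DecidableEq ι] [Fintype κ] [DecidableEq κ]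

theorem Matrix.permTrace_permCongr (e : ι ≃ κ) (σ : Equiv.Perm ι) (X : κ → Matrix n n R) :
    permTrace (e.permCongr σ) X = permTrace σ (X ∘ e) := by
  rw [permTrace, ← (e.arrowCongr (Equiv.refl n)).sum_comp]
  refine Finset.sum_congr rfl fun f _ => ?_
  rw [← e.prod_comp]
  simp

theorem Matrix.permTrace_eq_mul (σ : Equiv.Perm ι) (p : ι → Prop) [DecidablePred p]
    (h : ∀ i, p (σ i) ↔ p i) (X : ι → Matrix n n R) :
    permTrace σ X = permTrace (σ.subtypePerm h) (fun i => X i) *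
      permTrace (σ.subtypePerm (p := fun i => ¬ p i) fun i => not_congr (h i)) (fun i => X i) := by
  rw [permTrace, permTrace, permTrace, Finset.sum_mul_sum, ← Fintype.sum_prod_type',
    ← (Equiv.piEquivPiSubtypeProd p fun _ => n).symm.sum_comp]
  refine Finset.sum_congr rfl fun f _ => ?_
  rw [← Fintype.prod_subtype_mul_prod_subtype p]
  congr 1
  · refine Finset.prod_congr rfl fun i _ => ?_
    simp [Equiv.piEquivPiSubtypeProd, i.2, (h i).2 i.2]
  · refine Finset.prod_congr rfl fun i _ => ?_
    simp [Equiv.piEquivPiSubtypeProd, i.2, mt (h i).1 i.2]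

theorem Equiv.Perm.exists_permCongr_finRotate_eq [Nonempty ι] (σ : Equiv.Perm ι)
    (h : ∀ i j, σ.SameCycle i j) :
    ∃ (N : ℕ) (e : Fin (N + 1) ≃ ι), e.permCongr (finRotate (N + 1)) = σ := by
  obtain ⟨N, hN⟩ := Nat.exists_eq_succ_of_ne_zero (Fintype.card_ne_zero (α := ι))
  let e := (Fintype.equivFinOfCardEq hN).symm
  refine ⟨N, ?_⟩
  cases N with
  | zero =>
    have : Subsingleton ι := e.symm.injective.subsingleton
    exact ⟨e, Subsingleton.elim _ _⟩
  | succ N =>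
    have : Nontrivial ι := e.symm.nontrivial
    have hmove : ∀ i, σ i ≠ i := fun i hi => by
      obtain ⟨j, hj⟩ := exists_ne i
      exact hj ((h i j).eq_of_left hi).symm
    have hσ : σ.IsCycle := ⟨Classical.arbitrary ι, hmove _, fun j _ => h _ _⟩
    have hτ : (e.permCongr (finRotate (N + 2))).IsCycle := by
      obtain ⟨i, hi, hc⟩ := isCycle_finRotate (n := N)
      refine ⟨e i, by simp, fun j hj => ?_⟩
      obtain ⟨k, hk⟩ := hc (y := e.symm j) fun h' => hj (by simp [h'])
      refine ⟨k, ?_⟩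
      rw [← Equiv.permCongrHom_coe, ← map_zpow]
      simp [hk]
    have hs : σ.support = Finset.univ := by ext i; simp [hmove]
    have ht : (e.permCongr (finRotate (N + 2))).support = Finset.univ := by
      ext i
      rw [Equiv.Perm.mem_support]
      simp [← Equiv.eq_symm_apply]
    obtain ⟨g, hg⟩ := isConj_iff.1 (hτ.isConj hσ (by rw [hs, ht]))
    refine ⟨e.trans g, ?_⟩
    rw [← hg]
    ext i
    simp [Equiv.Perm.mul_apply]

theorem Matrix.permTrace_eq_permTrace_of_not_sameCycle {ι : Type u} [Fintype ι] [DecidableEq ι]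
    {L : Type*} {F G : L → Matrix n n R}
    (h : ∀ (κ : Type u) [Fintype κ] [DecidableEq κ], Fintype.card κ < Fintype.card ι →
      ∀ (σ : Equiv.Perm κ) (X : κ → L), permTrace σ (F ∘ X) = permTrace σ (G ∘ X))
    {σ : Equiv.Perm ι} {i j : ι} (hij : ¬ σ.SameCycle i j) (X : ι → L) :
    permTrace σ (F ∘ X) = permTrace σ (G ∘ X) := by
  classical
  have hp : ∀ k, σ.SameCycle i (σ k) ↔ σ.SameCycle i k := fun k =>
    Equiv.Perm.sameCycle_apply_right
  rw [permTrace_eq_mul σ _ hp, permTrace_eq_mul σ _ hp]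
  exact congrArg₂ (· * ·)
    (h {k // σ.SameCycle i k} (Fintype.card_subtype_lt hij) _ fun k => X k)
    (h {k // ¬ σ.SameCycle i k} (Fintype.card_subtype_lt (x := i) (not_not.2 (.refl σ i))) _
      fun k => X k)

theorem Matrix.permTrace_eq_permTrace_of_trace_word_eq [DecidableEq n] {L : Type*}
    {F G : L → Matrix n n R} {K : ℕ}
    (h : ∀ w : List L, w ≠ [] → w.length ≤ K → (w.map F).prod.trace = (w.map G).prod.trace)
    (ι : Type u) [Fintype ι] [DecidableEq ι] (hι : Fintype.card ι ≤ K) (σ : Equiv.Perm ι)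
    (X : ι → L) : permTrace σ (F ∘ X) = permTrace σ (G ∘ X) := by
  induction hd : Fintype.card ι using Nat.strong_induction_on generalizing ι with
  | _ d ih =>
    by_cases hσ : ∀ i j, σ.SameCycle i j
    · rcases isEmpty_or_nonempty ι with _ | _
      · simp [permTrace]
      · obtain ⟨N, e, rfl⟩ := σ.exists_permCongr_finRotate_eq hσ
        have hN : N + 1 ≤ K := by simpa [← Fintype.card_congr e] using hι
        have := h (List.ofFn (X ∘ e)) (by simp) (by simpa using hN)
        rw [permTrace_permCongr, permTrace_permCongr, permTrace_finRotate, permTrace_finRotate]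
        rwa [List.map_ofFn, List.map_ofFn] at this
    · push Not at hσ
      obtain ⟨i, j, hij⟩ := hσ
      exact permTrace_eq_permTrace_of_not_sameCycle
        (fun κ _ _ hκ τ Y => ih _ (hd ▸ hκ) κ (hκ.le.trans hι) τ Y rfl) hij X

end PermTrace

/-- The action of a permutation of `ι` on the tensor power `(ℂ ^ n) ^ ⊗ ι`, as a matrix. -/
def Equiv.Perm.tensorMatrix (ι n : Type*) [Fintype ι] [Fintype n] [DecidableEq ι] [DecidableEq n] :
    Equiv.Perm ι →* Matrix (ι → n) (ι → n) ℂ where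
  toFun σ := Matrix.of fun f g => if f ∘ σ = g then 1 else 0
  map_one' := by
    ext f g
    simp [Matrix.one_apply]
  map_mul' σ τ := by
    ext f g
    rw [Matrix.mul_apply, Finset.sum_eq_single (f ∘ σ)]
    · simp [Function.comp_assoc]
      rfl
    · intro k _ hk
      simp [Ne.symm hk]
    · simp

section TensorMatrix

open Equiv.Perm

variable {ι n : Type*}

theorem update_eq_update_iff_of_ne [DecidableEq ι] {i j : ι} (hij : i ≠ j) (f h : ι → n)
    (hf : f i = h j) (b : n) :
    Function.update f i b = Function.update h j b ↔ b = f j ∧ f ∘ Equiv.swap i j = h := by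
  constructor
  · intro e
    have hb : b = f j := by
      have := congrFun e j
      rw [Function.update_self, Function.update_of_ne hij.symm] at this
      exact this.symm
    refine ⟨hb, ?_⟩
    ext k
    have := congrFun e k
    by_cases hki : k = i
    · subst hki
      simp_all [Function.update_of_ne]
    · by_cases hkj : k = j
      · subst hkj; simp [hf]
      · simpa [Equiv.swap_apply_of_ne_of_ne, hki, hkj] using this
  · rintro ⟨rfl, rfl⟩
    ext k
    by_cases hki : k = i
    · subst hki; simp [Function.update_of_ne, hij]
    · by_cases hkj : k = j
      · subst hkj; simp [Function.update_of_ne, hij.symm]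
      · simp [Equiv.swap_apply_of_ne_of_ne, hki, hkj]

variable [Fintype ι] [Fintype n] [DecidableEq n]

theorem card_mul_card_lt_sum_sum_ite (h : Fintype.card n ^ 2 < Fintype.card ι) (f : ι → n) :
    Fintype.card n * Fintype.card ι < ∑ i, ∑ j, if f i = f j then 1 else 0 := by
  have h1 : (∑ i, ∑ j, if f i = f j then 1 else 0) =
      ∑ a, (∑ i, if f i = a then 1 else 0) ^ 2 := by
    simp_rw [sq, Finset.sum_mul_sum]
    rw [Finset.sum_comm]
    conv_rhs => rw [Finset.sum_comm]
    rw [Finset.sum_comm]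
    refine Finset.sum_congr rfl fun i _ => ?_
    rw [Finset.sum_comm]
    refine Finset.sum_congr rfl fun j _ => ?_
    simp [eq_comm]
  have h2 : ∑ a, (∑ i, if f i = a then 1 else 0) = Fintype.card ι := by
    rw [Finset.sum_comm]; simp
  have h3 := sq_sum_le_card_mul_sum_sq (s := Finset.univ)
    (f := fun a => ∑ i, if f i = a then 1 else 0)
  rw [h2, Finset.card_univ, ← h1] at h3
  refine lt_of_mul_lt_mul_left (lt_of_lt_of_le ?_ h3) (Nat.zero_le (Fintype.card n))
  have : 0 < Fintype.card ι := by omega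
  nlinarith

variable [DecidableEq ι]

theorem Equiv.Perm.tensorMatrix_apply (σ : Equiv.Perm ι) (f g : ι → n) :
    tensorMatrix ι n σ f g = if f ∘ σ = g then 1 else 0 := rfl

/-- On a tensor power of degree larger than `(dim V)²` of `V = ℂ ^ n`, the sum of all transpositions
is positive definite. -/
theorem posDef_sum_tensorMatrix_swap (h : Fintype.card n ^ 2 < Fintype.card ι) :
    (∑ i, ∑ j, if i ≠ j then tensorMatrix ι n (Equiv.swap i j) else 0).PosDef := by
  let Q : Matrix (ι → n) (n × n × (ι → n)) ℂ := fun f x => ∑ i,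
    if x.1 ≠ x.2.1 ∧ f i = x.1 ∧ Function.update f i x.2.1 = x.2.2 then 1 else 0
  let d : (ι → n) → ℝ := fun f =>
    ∑ i, ∑ j, ((if f i = f j then 1 else 0) - if i = j then (Fintype.card n : ℝ) else 0)
  have hd : ∀ f, 0 < d f := by
    intro f
    have := card_mul_card_lt_sum_sum_ite h f
    have h' : ((Fintype.card n * Fintype.card ι : ℕ) : ℝ) <
      ((∑ i, ∑ j, if f i = f j then 1 else 0 : ℕ) : ℝ) := by exact_mod_cast this
    push_cast at h'
    simp only [d, Finset.sum_sub_distrib]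
    simpa [mul_comm] using h'
  have key : (∑ i, ∑ j, if i ≠ j then tensorMatrix ι n (Equiv.swap i j) else 0) =
      diagonal (fun f => (d f : ℂ)) + Q * Qᴴ := by
    have hQ (f g : ι → n) (i j : ι) : (∑ x : n × n × (ι → n),
        (if x.1 ≠ x.2.1 ∧ f i = x.1 ∧ Function.update f i x.2.1 = x.2.2 then (1 : ℂ) else 0) *
        (if x.1 ≠ x.2.1 ∧ g j = x.1 ∧ Function.update g j x.2.1 = x.2.2 then (1 : ℂ) else 0)) =
        ∑ b, if f i ≠ b ∧ f i = g j ∧ Function.update f i b = Function.update g j b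
          then 1 else 0 := by
      rw [Fintype.sum_prod_type, Finset.sum_eq_single (f i)]
      · rw [Fintype.sum_prod_type]
        refine Finset.sum_congr rfl fun b _ => ?_
        rw [Finset.sum_eq_single (Function.update f i b)]
        · rw [mul_ite, mul_one, mul_zero, ← ite_and]
          refine if_congr ?_ rfl rfl
          grind
        · intro k _ hk
          simp [Ne.symm hk]
        · simp
      · intro a _ ha
        simp [Ne.symm ha]
      · simp
    have hQQ (f g : ι → n) : (Q * Qᴴ) f g = ∑ i, ∑ j,
        ∑ b, if f i ≠ b ∧ f i = g j ∧ Function.update f i b = Function.update g j b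
          then 1 else 0 := by
      rw [Matrix.mul_apply]
      simp only [← hQ]
      have hstar (x) : Qᴴ x g = Q g x := by
        rw [conjTranspose_apply]
        refine (star_sum _ _).trans ?_
        refine Finset.sum_congr rfl fun i _ => ?_
        split_ifs <;> simp
      simp only [hstar, Q, Finset.sum_mul_sum]
      refine Finset.sum_comm.trans (Finset.sum_congr rfl fun i _ => Finset.sum_comm)
    have hterm (f g : ι → n) (i j : ι) :
        (if i ≠ j then tensorMatrix ι n (Equiv.swap i j) else 0) f g =
          (if f = g then ((if f i = f j then 1 else 0) - if i = j then (Fintype.card n : ℂ) else 0)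
            else 0) +
          ∑ b, if f i ≠ b ∧ f i = g j ∧ Function.update f i b = Function.update g j b
            then 1 else 0 := by
      rcases eq_or_ne i j with rfl | hij
      · by_cases hfg : f = g
        · subst hfg
          have hb (b : n) : (if f i = b then (0 : ℂ) else 1) = 1 - if f i = b then 1 else 0 := by
            split_ifs <;> simp
          simp [hb]
        · have : ∀ b, ¬ (f i ≠ b ∧ f i = g i ∧ Function.update f i b = Function.update g i b) := by
            rintro b ⟨-, h1, h2⟩
            refine hfg (funext fun k => ?_)
            rcases eq_or_ne k i with rfl | hk
            · exact h1
            · simpa [hk] using congrFun h2 k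
          simp [this, hfg]
      · have hb (b : n) : (f i ≠ b ∧ f i = g j ∧ Function.update f i b = Function.update g j b) ↔
            b = f j ∧ f i ≠ f j ∧ f ∘ Equiv.swap i j = g := by
          constructor
          · rintro ⟨h1, h2, h3⟩
            obtain ⟨rfl, h4⟩ := (update_eq_update_iff_of_ne hij f g h2 b).1 h3
            exact ⟨rfl, h1, h4⟩
          · rintro ⟨rfl, h1, h4⟩
            have h2 : f i = g j := by rw [← h4]; simp
            exact ⟨h1, h2, (update_eq_update_iff_of_ne hij f g h2 _).2 ⟨rfl, h4⟩⟩
        simp only [hb, ite_and, Finset.sum_ite_eq', Finset.mem_univ, if_true, if_pos hij,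
          tensorMatrix_apply, if_neg hij, sub_zero]
        by_cases hf : f i = f j
        · have hs : f ∘ Equiv.swap i j = f := by
            ext k
            rcases eq_or_ne k i with rfl | hk
            · simp [hf]
            · rcases eq_or_ne k j with rfl | hk'
              · simp [hf]
              · simp [Equiv.swap_apply_of_ne_of_ne hk hk']
          simp [hf, hs]
        · simp [hf]
    ext f g
    rw [Matrix.add_apply, hQQ]
    simp only [Matrix.sum_apply, hterm, Finset.sum_add_distrib]
    congr 1
    rw [diagonal_apply]
    split_ifs with hfg
    · simp only [d]
      push_cast
      simp only [apply_ite Complex.ofReal, Complex.ofReal_one, Complex.ofReal_zero,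
        Complex.ofReal_natCast]
    · simp
  rw [key]
  refine Matrix.PosDef.add_posSemidef ?_ (posSemidef_self_mul_conjTranspose Q)
  rw [posDef_diagonal_iff]
  exact fun f => by exact_mod_cast hd f

/-- The action of a permutation of `ι` on the tensor power `(ℂ ^ n) ^ ⊗ ι`, twisted by the sign. -/
noncomputable def Equiv.Perm.signedTensorMatrix (ι n : Type*) [Fintype ι] [Fintype n]
    [DecidableEq ι] [DecidableEq n] : Equiv.Perm ι →* Matrix (ι → n) (ι → n) ℂ where
  toFun σ := ((sign σ : ℤ) : ℂ) • tensorMatrix ι n σ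
  map_one' := by simp
  map_mul' σ τ := by simp [smul_smul, mul_comm]

open Polynomial in
theorem isCoprime_charpoly_comp_neg_X {m : Type*} [Fintype m] [DecidableEq m] {H : Matrix m m ℂ}
    (hH : H.PosDef) : IsCoprime H.charpoly (H.charpoly.comp (-X)) := by
  rw [Polynomial.isCoprime_iff_aeval_ne_zero_of_isAlgClosed ℂ ℂ]
  intro z
  by_contra! hz
  have hroot : ∀ x : ℂ, H.charpoly.eval x = 0 → 0 < x := by
    intro x hx
    rw [hH.isHermitian.charpoly_eq, Polynomial.eval_prod, Finset.prod_eq_zero_iff] at hx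
    obtain ⟨i, -, hi⟩ := hx
    simp only [eval_sub, eval_X, eval_C, sub_eq_zero] at hi
    rw [hi]
    exact Complex.zero_lt_real.2 (hH.eigenvalues_pos i)
  have h1 := hroot z (by simpa [aeval_def, eval₂_eq_eval_map] using hz.1)
  have h2 := hroot (-z) (by simpa [aeval_def, eval₂_eq_eval_map, eval_comp] using hz.2)
  exact lt_asymm h1 (neg_pos.1 h2)

/-- Above degree `(dim V)²`, every permutation is the sum of an element of the group algebra acting
as zero on the tensor power and one acting as zero on its sign twist. -/
theorem exists_sum_smul_tensorMatrix_eq_zero (h : Fintype.card n ^ 2 < Fintype.card ι)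
    (c : Equiv.Perm ι) :
    ∃ x y : Equiv.Perm ι → ℂ, (∀ σ, x σ + y σ = if σ = c then 1 else 0) ∧
      ∑ σ, x σ • tensorMatrix ι n σ = 0 ∧ ∑ σ, (y σ * (sign σ : ℤ)) • tensorMatrix ι n σ = 0 := by
  let ρ := MonoidAlgebra.lift ℂ _ _ (tensorMatrix ι n)
  let ρ' := MonoidAlgebra.lift ℂ _ _ (signedTensorMatrix ι n)
  let T : MonoidAlgebra ℂ (Equiv.Perm ι) :=
    ∑ i, ∑ j, if i ≠ j then MonoidAlgebra.of ℂ _ (Equiv.swap i j) else 0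
  set H : Matrix (ι → n) (ι → n) ℂ :=
    ∑ i, ∑ j, if i ≠ j then tensorMatrix ι n (Equiv.swap i j) else 0 with hH
  have hρ : ρ T = H := by
    simp only [T, hH, map_sum]
    refine Finset.sum_congr rfl fun i _ => Finset.sum_congr rfl fun j _ => ?_
    split_ifs
    · simp [ρ]
    · simp
  have hρ' : ρ' T = -H := by
    simp only [T, hH, map_sum, ← Finset.sum_neg_distrib]
    refine Finset.sum_congr rfl fun i _ => Finset.sum_congr rfl fun j _ => ?_
    split_ifs with hij
    · simp [ρ', signedTensorMatrix, sign_swap hij]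
    · simp
  obtain ⟨u, v, huv⟩ := isCoprime_charpoly_comp_neg_X (posDef_sum_tensorMatrix_swap h)
  rw [← hH] at huv
  let a := MonoidAlgebra.of ℂ _ c * Polynomial.aeval T (u * H.charpoly)
  let b := MonoidAlgebra.of ℂ _ c * Polynomial.aeval T (v * H.charpoly.comp (-Polynomial.X))
  have hab : a + b = MonoidAlgebra.of ℂ _ c := by
    simp only [a, b]
    rw [← mul_add, ← map_add, huv, map_one, mul_one]
  have ha : ρ a = 0 := by
    simp only [a]
    rw [map_mul, ← Polynomial.aeval_algHom_apply, hρ, map_mul, Matrix.aeval_self_charpoly, mul_zero,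
      mul_zero]
  have hb : ρ' b = 0 := by
    simp only [b]
    rw [map_mul, ← Polynomial.aeval_algHom_apply, hρ', map_mul, Polynomial.aeval_comp, map_neg,
      Polynomial.aeval_X, neg_neg, Matrix.aeval_self_charpoly, mul_zero, mul_zero]
  refine ⟨fun σ => a.coeff σ, fun σ => b.coeff σ, fun σ => ?_, ?_, ?_⟩
  · have := DFunLike.congr_fun (congrArg MonoidAlgebra.coeff hab) σ
    simpa [Finsupp.single_apply, eq_comm] using this
  · rw [← ha]
    simp only [ρ, MonoidAlgebra.lift_apply]
    rw [Finsupp.sum_fintype _ _ (by simp)]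
  · rw [← hb]
    simp only [ρ', MonoidAlgebra.lift_apply]
    rw [Finsupp.sum_fintype _ _ (by simp)]
    simp [signedTensorMatrix, smul_smul]

end TensorMatrix

end ComplexOrder

section TraceWords

open Equiv.Perm

variable {n : Type*} [Fintype n] [DecidableEq n]

theorem Matrix.sum_mul_permTrace_eq_zero {ι : Type*} [Fintype ι] [DecidableEq ι]
    {a : Equiv.Perm ι → ℂ} (ha : ∑ σ, a σ • tensorMatrix ι n σ = 0) (X : ι → Matrix n n ℂ) :
    ∑ σ, a σ * permTrace σ X = 0 := by
  have h (σ : Equiv.Perm ι) : permTrace σ X =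
      ∑ f, ∑ g, tensorMatrix ι n σ f g * ∏ i, X i (f i) (g i) := by
    simp [permTrace, tensorMatrix_apply]
  have h0 (f g : ι → n) : ∑ σ, a σ * tensorMatrix ι n σ f g = 0 := by
    simpa [Matrix.sum_apply] using congrFun (congrFun ha f) g
  simp only [h, Finset.mul_sum]
  rw [Finset.sum_comm]
  refine Finset.sum_eq_zero fun f _ => ?_
  rw [Finset.sum_comm]
  refine Finset.sum_eq_zero fun g _ => ?_
  simp only [← mul_assoc]
  rw [← Finset.sum_mul, h0, zero_mul]

theorem Matrix.permTrace_finRotate_eq_of_trace_word_eq {L : Type*} {F G : L → Matrix n n ℂ} {N : ℕ}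
    (hN : Fintype.card n ^ 2 ≤ N)
    (h : ∀ w : List L, w ≠ [] → w.length ≤ N → (w.map F).prod.trace = (w.map G).prod.trace)
    (X : Fin (N + 1) → L) :
    permTrace (finRotate (N + 1)) (F ∘ X) = permTrace (finRotate (N + 1)) (G ∘ X) := by
  obtain ⟨x, y, hxy, hx, hy⟩ := exists_sum_smul_tensorMatrix_eq_zero (n := n) (ι := Fin (N + 1))
    (by simpa using Nat.lt_succ_of_le hN) (finRotate (N + 1))
  let D : Equiv.Perm (Fin (N + 1)) → ℂ := fun σ => permTrace σ (F ∘ X) - permTrace σ (G ∘ X)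
  have hsum {a : Equiv.Perm (Fin (N + 1)) → ℂ} (ha : ∑ σ, a σ • tensorMatrix _ n σ = 0) :
      ∑ σ, a σ * D σ = 0 := by
    simp only [D, mul_sub, Finset.sum_sub_distrib, sum_mul_permTrace_eq_zero ha, sub_zero]
  have hsign (σ : Equiv.Perm (Fin (N + 1))) : ((sign σ : ℤ) : ℂ) * D σ = (-1) ^ N * D σ := by
    by_cases hσ : ∀ i j, σ.SameCycle i j
    · obtain ⟨M, e, rfl⟩ := σ.exists_permCongr_finRotate_eq hσ
      have hM : M = N := by simpa using Fintype.card_congr e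
      subst hM
      rw [Equiv.Perm.sign_permCongr, sign_finRotate]
      simp
    · push Not at hσ
      obtain ⟨i, j, hij⟩ := hσ
      have : D σ = 0 := sub_eq_zero.2 <| permTrace_eq_permTrace_of_not_sameCycle
        (fun κ _ _ hκ => permTrace_eq_permTrace_of_trace_word_eq h κ
          (Nat.le_of_lt_succ (by simpa using hκ))) hij X
      simp [this]
  have hy' : ∑ σ, y σ * D σ = 0 := by
    have := hsum hy
    simp only [mul_assoc, hsign] at this
    simp only [mul_left_comm _ ((-1 : ℂ) ^ N), ← Finset.mul_sum] at this
    exact (mul_eq_zero.1 this).resolve_left (by simp)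
  have hD : D (finRotate (N + 1)) = ∑ σ, (x σ + y σ) * D σ := by
    simp [hxy]
  simp only [add_mul, Finset.sum_add_distrib, hsum hx, hy', add_zero] at hD
  exact sub_eq_zero.1 hD

/-- The traces of the words of length at most `n²` determine the traces of all words. -/
theorem Matrix.trace_word_eq_of_length_le_card_sq {L : Type*} {F G : L → Matrix n n ℂ}
    (h : ∀ w : List L, w ≠ [] → w.length ≤ Fintype.card n ^ 2 →
      (w.map F).prod.trace = (w.map G).prod.trace) (w : List L) :
    (w.map F).prod.trace = (w.map G).prod.trace := by
  induction hw : w.length using Nat.strong_induction_on generalizing w with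
  | _ k ih =>
    subst hw
    rcases eq_or_ne w [] with rfl | hne
    · simp
    rcases le_or_gt w.length (Fintype.card n ^ 2) with hle | hlt
    · exact h w hne hle
    obtain ⟨N, hN⟩ := Nat.exists_eq_add_one_of_ne_zero (Nat.ne_zero_of_lt hlt)
    obtain ⟨X, rfl⟩ : ∃ X : Fin (N + 1) → L, List.ofFn X = w := by
      rw [← hN]
      exact ⟨w.get, List.ofFn_get w⟩
    rw [hN] at hlt ih
    have := permTrace_finRotate_eq_of_trace_word_eq (Nat.le_of_lt_succ hlt)
      (fun w _ hw => ih _ (Nat.lt_succ_of_le hw) w rfl) X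
    rwa [permTrace_finRotate, permTrace_finRotate, ← List.map_ofFn, ← List.map_ofFn] at this

theorem Matrix.trace_prod_map_conj {L R : Type*} [CommRing R] {U V : Matrix n n R} (hUV : U * V = 1)
    (F : L → Matrix n n R) (w : List L) :
    (w.map fun l => V * F l * U).prod.trace = (w.map F).prod.trace := by
  have hVU := mul_eq_one_comm.1 hUV
  have : (w.map fun l => V * F l * U).prod = V * (w.map F).prod * U := by
    induction w with
    | nil => simp [hVU]
    | cons l w ih =>
      simp only [List.map_cons, List.prod_cons, ih]
      calc V * F l * U * (V * (w.map F).prod * U)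
          = V * F l * (U * V) * (w.map F).prod * U := by simp only [mul_assoc]
        _ = V * (F l * (w.map F).prod) * U := by simp only [hUV, mul_one, mul_assoc]
  rw [this, trace_mul_comm, ← mul_assoc, hUV, one_mul]

end TraceWords

/-- Specht property for ℂ with bound `n²`: two `m`-tuples of `n × n` complex matrices are
simultaneously unitarily similar iff all traces of words of length at most `n²` in the
matrices and their conjugate transposes agree. A word in `2m` non-commuting letters is a
nonempty list over the alphabet `Fin m ⊕ Fin m`, where the letter `Sum.inl i` is evaluated
at the `i`-th matrix and `Sum.inr i` at its conjugate transpose. -/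
theorem specht_complex (n m : ℕ) (hn : 1 ≤ n) (hm : 1 ≤ m)
    (A B : Fin m → Matrix (Fin n) (Fin n) ℂ) :
    (∃ U : Matrix (Fin n) (Fin n) ℂ, Uᴴ * U = 1 ∧ ∀ i : Fin m, Uᴴ * A i * U = B i) ↔
      (∀ w : List (Fin m ⊕ Fin m), w ≠ [] → w.length ≤ n ^ 2 →
        ((w.map (Sum.elim A (fun i => (A i)ᴴ))).prod).trace =
          ((w.map (Sum.elim B (fun i => (B i)ᴴ))).prod).trace) := by
  constructor
  · rintro ⟨U, hU, h⟩ w - -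
    rw [← trace_prod_map_conj (mul_eq_one_comm.1 hU) (Sum.elim A fun i => (A i)ᴴ)]
    congr 3
    funext l
    rcases l with i | i
    · exact h i
    · simp [← h i, mul_assoc]
  · intro h
    obtain ⟨S, hS, hSA⟩ := exists_intertwiner_of_trace_word_eq
      (Sum.elim A fun i => (A i)ᴴ) (Sum.elim B fun i => (B i)ᴴ)
      (by rintro (i | i); exacts [⟨.inr i, rfl⟩, ⟨.inl i, by simp⟩])
      (by rintro (i | i); exacts [⟨.inr i, rfl⟩, ⟨.inl i, by simp⟩])
      (trace_word_eq_of_length_le_card_sq (by simpa using h))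
    exact exists_unitary_of_isUnit_intertwiner A B S hS (fun i => hSA (.inl i))
      fun i => hSA (.inr i)
end

section
/- Consider the first-order language L consisting of the ring language (constants 0, 1, binary functions +, ·) together with a unary function symbol * and a binary relation symbol ≤. Make ℂ an L-structure by interpreting the ring symbols as usual, * as complex conjugation, and ≤ as the binary relation { (a,b) ∈ ℂ² : a and b are real and a ≤ b in ℝ }. Then this structure admits quantifier elimination: for every L-formula φ(x_1,…,x_m) there is a quantifier-free L-formula ψ(x_1,…,x_m) defining the same subset of ℂ^m. -/
open FirstOrder FirstOrder.Language

/-- Function symbols of the ring language extended by a unary symbol `*`. -/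
inductive CFunc : ℕ → Type
  | zero : CFunc 0
  | one : CFunc 0
  | add : CFunc 2
  | mul : CFunc 2
  | star : CFunc 1

/-- Relation symbols: a single binary relation `≤`. -/
inductive CRel : ℕ → Type
  | le : CRel 2

/-- The language of rings extended by a unary function symbol `*` and a binary relation
symbol `≤`. -/
def cLang : Language := ⟨CFunc, CRel⟩

/-- `ℂ` as a `cLang`-structure: ring symbols as usual, `*` as complex conjugation, and
`≤` as the relation "both arguments are real and comparison holds in `ℝ`". -/
noncomputable instance cStructure : cLang.Structure ℂ where
  funMap {arity} f x :=
    match f, x with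
    | .zero, _ => 0
    | .one, _ => 1
    | .add, x => x 0 + x 1
    | .mul, x => x 0 * x 1
    | .star, x => starRingEnd ℂ (x 0)
  RelMap {arity} r x :=
    match r, x with
    | .le, x => (x 0).im = 0 ∧ (x 1).im = 0 ∧ (x 0).re ≤ (x 1).re

theorem exists_orderIso_map_eq_of_lt {a b u v : ℝ} (hau : a < u) (huv : u < v) (hvb : v < b) :
    ∃ g : ℝ ≃o ℝ, g u = v ∧ ∀ x, x ∉ Set.Ioo a b → g x = x := by
  have h1 : 0 < u - a := sub_pos.2 hau
  have h2 : 0 < b - u := sub_pos.2 (huv.trans hvb)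
  have s1 : 1 < (v - a) / (u - a) := by rw [lt_div_iff₀ h1]; linarith
  have s2 : (b - v) / (b - u) < 1 := by rw [div_lt_iff₀ h2]; linarith
  have s2' : 0 < (b - v) / (b - u) := div_pos (sub_pos.2 hvb) h2
  set c := (v - a) / (u - a) with hc
  set d := (b - v) / (b - u) with hd
  let f : ℝ → ℝ := fun x => max x (min (a + c * (x - a)) (b - d * (b - x)))
  have hmono : StrictMono f := by
    intro x y hxy
    have e1 : a + c * (x - a) < a + c * (y - a) := by nlinarith
    have e2 : b - d * (b - x) < b - d * (b - y) := by nlinarith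
    exact max_lt_max hxy (min_lt_min e1 e2)
  have hfix : ∀ x, x ∉ Set.Ioo a b → f x = x := by
    intro x hx
    apply max_eq_left
    rw [Set.mem_Ioo, not_and_or, not_lt, not_lt] at hx
    rcases hx with hx | hx
    · exact (min_le_left _ _).trans (by nlinarith)
    · exact (min_le_right _ _).trans (by nlinarith)
  have hcont : Continuous f := by fun_prop
  have hsurj : Function.Surjective f := by
    apply hcont.surjective
    · refine Filter.tendsto_id.congr' ?_
      filter_upwards [Filter.eventually_ge_atTop b] with x hx
      exact (hfix x fun h => absurd h.2 (not_lt.2 hx)).symm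
    · refine Filter.tendsto_id.congr' ?_
      filter_upwards [Filter.eventually_le_atBot a] with x hx
      exact (hfix x fun h => absurd h.1 (not_lt.2 hx)).symm
  refine ⟨hmono.orderIsoOfSurjective f hsurj, ?_, hfix⟩
  have e1 : a + c * (u - a) = v := by rw [hc]; field_simp; ring
  have e2 : b - d * (b - u) = v := by rw [hd]; field_simp; ring
  change max u (min (a + c * (u - a)) (b - d * (b - u))) = v
  rw [e1, e2, min_self, max_eq_right huv.le]

/-- An order automorphism of `ℝ` supported in an open interval can move any point of the interval
to any other one. -/
theorem exists_orderIso_map_eq {a b u v : ℝ} (hu : u ∈ Set.Ioo a b) (hv : v ∈ Set.Ioo a b) :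
    ∃ g : ℝ ≃o ℝ, g u = v ∧ ∀ x, x ∉ Set.Ioo a b → g x = x := by
  rcases lt_trichotomy u v with h | rfl | h
  · exact exists_orderIso_map_eq_of_lt hu.1 h hv.2
  · exact ⟨OrderIso.refl ℝ, rfl, fun _ _ => rfl⟩
  · obtain ⟨g, hg, hfix⟩ := exists_orderIso_map_eq_of_lt hv.1 h hu.2
    refine ⟨g.symm, by rw [← hg, g.symm_apply_apply], fun x hx => ?_⟩
    rw [OrderIso.symm_apply_eq, hfix x hx]

theorem sign_eq_of_forall_ne_zero {f : ℝ → ℝ} (hf : Continuous f) {a b : ℝ}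
    (h : ∀ x ∈ Set.uIcc a b, f x ≠ 0) : SignType.sign (f a) = SignType.sign (f b) := by
  have key : ∀ y, y ∈ Set.uIcc (f a) (f b) → y ≠ 0 := by
    intro y hy
    obtain ⟨x, hx, rfl⟩ := intermediate_value_uIcc hf.continuousOn hy
    exact h x hx
  have h0 : (0 : ℝ) ∉ Set.uIcc (f a) (f b) := fun h => key 0 h rfl
  rw [Set.mem_uIcc] at h0
  push Not at h0
  rcases lt_trichotomy (f a) 0 with ha | ha | ha
  · rw [sign_neg ha, sign_neg (h0.1 ha.le)]
  · exact absurd ha (h a Set.left_mem_uIcc)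
  · rcases lt_trichotomy (f b) 0 with hb | hb | hb
    · exact absurd (h0.2 hb.le) (not_lt.2 ha.le)
    · exact absurd hb (h b Set.right_mem_uIcc)
    · rw [sign_pos ha, sign_pos hb]

/-- `P` is a continuous unbounded function which is strictly monotone between consecutive points
of `Z`, the direction of monotonicity being recorded by `D`. -/
structure PiecewiseStrict (Z : Set ℝ) (D : ℝ → SignType) (P : ℝ → ℝ) : Prop where
  continuous : Continuous P
  tendsto_atTop : Filter.Tendsto (fun x => |P x|) Filter.atTop Filter.atTop
  tendsto_atBot : Filter.Tendsto (fun x => |P x|) Filter.atBot Filter.atTop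
  sign_sub : ∀ a b c, a < b → (∀ x ∈ Set.Ioo a b, x ∉ Z) → c ∈ Set.Icc a b → c ∉ Z →
    SignType.sign (P b - P a) = D c
  dir_ne_zero : ∀ c, c ∉ Z → D c ≠ 0

namespace PiecewiseStrict

variable {Z : Set ℝ} {D : ℝ → SignType} {P Q : ℝ → ℝ}

theorem neg (hP : PiecewiseStrict Z D P) :
    PiecewiseStrict Z (fun x => - D x) (fun x => - P x) where
  continuous := hP.continuous.neg
  tendsto_atTop := by simpa only [abs_neg] using hP.tendsto_atTop
  tendsto_atBot := by simpa only [abs_neg] using hP.tendsto_atBot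
  sign_sub a b c hab hZ hc hcZ := by
    rw [← hP.sign_sub a b c hab hZ hc hcZ, ← Left.sign_neg]
    congr 1; ring
  dir_ne_zero c hc := by simpa using hP.dir_ne_zero c hc

theorem reflect (hP : PiecewiseStrict Z D P) :
    PiecewiseStrict (Neg.neg ⁻¹' Z) (fun x => D (-x)) (fun x => - P (-x)) where
  continuous := (hP.continuous.comp continuous_neg).neg
  tendsto_atTop := by
    simp only [abs_neg]
    exact hP.tendsto_atBot.comp Filter.tendsto_neg_atTop_atBot
  tendsto_atBot := by
    simp only [abs_neg]
    exact hP.tendsto_atTop.comp Filter.tendsto_neg_atBot_atTop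
  sign_sub a b c hab hZ hc hcZ := by
    rw [← hP.sign_sub (-b) (-a) (-c) (neg_lt_neg hab) ?_ ⟨neg_le_neg hc.2, neg_le_neg hc.1⟩ hcZ]
    · congr 1; ring
    · intro x hx
      have := hZ (-x) ⟨by linarith [hx.2], by linarith [hx.1]⟩
      simpa using this
  dir_ne_zero c hc := hP.dir_ne_zero _ hc

theorem exists_neg_left (hZ : Z.Finite) (hP : PiecewiseStrict Z D P) (hQ : PiecewiseStrict Z D Q)
    (hPQ : ∀ z ∈ Z, SignType.sign (P z) = SignType.sign (Q z)) {t : ℝ} (ht : t ∉ Z) (hD : D t = 1)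
    (hPt : P t ≤ 0) : ∃ s < t, (∀ x ∈ Set.Icc s t, x ∉ Z) ∧ Q s < 0 := by
  by_cases hne : (Z ∩ Set.Iio t).Nonempty
  · obtain ⟨z, ⟨hzZ, hzt⟩, hmax⟩ :=
      Set.exists_max_image _ id (hZ.inter_of_left (Set.Iio t)) hne
    have hzt : z < t := hzt
    have hfree : ∀ x, z < x → x ≤ t → x ∉ Z := by
      intro x hzx hxt hxZ
      rcases hxt.lt_or_eq with h | rfl
      · exact absurd (hmax x ⟨hxZ, h⟩) (not_le.2 hzx)
      · exact ht hxZ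
    have h1 := hP.sign_sub z t t hzt (fun x hx => hfree x hx.1 hx.2.le) ⟨hzt.le, le_rfl⟩ ht
    rw [hD, sign_eq_one_iff] at h1
    have h2 : P z < 0 := by linarith
    have h3 : Q z < 0 := by
      rw [← sign_eq_neg_one_iff, ← hPQ z hzZ, sign_eq_neg_one_iff]; exact h2
    have h4 : ∀ᶠ x in nhdsWithin z (Set.Ioi z), Q x < 0 :=
      (hQ.continuous.tendsto z).eventually_lt_const h3 |>.filter_mono nhdsWithin_le_nhds
    obtain ⟨s, hs, hs'⟩ := (h4.and (Ioo_mem_nhdsGT hzt)).exists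
    exact ⟨s, hs'.2, fun x hx => hfree x (hs'.1.trans_le hx.1) hx.2, hs⟩
  · have hfree : ∀ x ≤ t, x ∉ Z := by
      intro x hxt hxZ
      rcases hxt.lt_or_eq with h | rfl
      · exact hne ⟨x, hxZ, h⟩
      · exact ht hxZ
    obtain ⟨s, hs, hst⟩ := ((hQ.tendsto_atBot.eventually_gt_atTop |Q t|).and
      (Filter.eventually_lt_atBot t)).exists
    refine ⟨s, hst, fun x hx => hfree x hx.2, ?_⟩
    have h1 := hQ.sign_sub s t t hst (fun x hx => hfree x hx.2.le) ⟨hst.le, le_rfl⟩ ht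
    rw [hD, sign_eq_one_iff] at h1
    by_contra h
    rw [abs_of_nonneg (not_lt.1 h)] at hs
    linarith [le_abs_self (Q t)]

theorem exists_root_of_pos (hZ : Z.Finite) (hP : PiecewiseStrict Z D P)
    (hQ : PiecewiseStrict Z D Q) (hPQ : ∀ z ∈ Z, SignType.sign (P z) = SignType.sign (Q z)) {t : ℝ}
    (ht : t ∉ Z) (hD : D t = 1) (hPt : P t ≤ 0) (hQt : 0 ≤ Q t) :
    ∃ s, Q s = 0 ∧ ∀ x ∈ Set.uIcc t s, x ∉ Z := by
  obtain ⟨s, hst, hfree, hs⟩ := hP.exists_neg_left hZ hQ hPQ ht hD hPt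
  obtain ⟨r, hr, hr0⟩ := intermediate_value_Icc hst.le hQ.continuous.continuousOn ⟨hs.le, hQt⟩
  refine ⟨r, hr0, fun x hx => hfree x ?_⟩
  rw [Set.uIcc_of_ge hr.2] at hx
  exact ⟨hr.1.trans hx.1, hx.2⟩

theorem exists_root_of_dir_eq_one (hZ : Z.Finite) (hP : PiecewiseStrict Z D P)
    (hQ : PiecewiseStrict Z D Q) (hPQ : ∀ z ∈ Z, SignType.sign (P z) = SignType.sign (Q z)) {t : ℝ}
    (ht : t ∉ Z) (hD : D t = 1) (hne : SignType.sign (P t) ≠ SignType.sign (Q t)) :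
    ∃ s, Q s = 0 ∧ ∀ x ∈ Set.uIcc t s, x ∉ Z := by
  rcases lt_trichotomy (Q t) 0 with h | h | h
  · have hPt : 0 ≤ P t := by
      by_contra h'
      exact hne (by rw [sign_neg h, sign_neg (not_le.1 h')])
    obtain ⟨s, hs, hfree⟩ := hP.reflect.exists_root_of_pos (hZ.preimage neg_injective.injOn)
      hQ.reflect (t := -t)
      (fun z hz => by rw [Left.sign_neg, Left.sign_neg, hPQ (-z) hz]) (by simpa using ht)
      (by simpa using hD) (by simpa using hPt) (by simpa using h.le)
    refine ⟨-s, by simpa using hs, fun x hx => ?_⟩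
    have := hfree (-x) (by
      rw [Set.mem_uIcc] at hx ⊢
      rcases hx with hx | hx
      · right; constructor <;> linarith
      · left; constructor <;> linarith)
    simpa using this
  · refine ⟨t, h, fun x hx => ?_⟩
    rw [Set.uIcc_self, Set.mem_singleton_iff] at hx
    rwa [hx]
  · refine hP.exists_root_of_pos hZ hQ hPQ ht hD ?_ h.le
    by_contra hPt
    exact hne (by rw [sign_pos h, sign_pos (not_le.1 hPt)])

/-- If `P` and `Q` have the same signs on `Z` but different signs at `t`, then `Q` has a root in
the component of `Zᶜ` containing `t`. -/
theorem exists_root (hZ : Z.Finite) (hP : PiecewiseStrict Z D P)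
    (hQ : PiecewiseStrict Z D Q) (hPQ : ∀ z ∈ Z, SignType.sign (P z) = SignType.sign (Q z)) {t : ℝ}
    (ht : t ∉ Z) (hne : SignType.sign (P t) ≠ SignType.sign (Q t)) :
    ∃ s, Q s = 0 ∧ ∀ x ∈ Set.uIcc t s, x ∉ Z := by
  rcases hd : D t with _ | _ | _
  · exact absurd hd (hP.dir_ne_zero t ht)
  · obtain ⟨s, hs, hfree⟩ := hP.neg.exists_root_of_dir_eq_one hZ hQ.neg (t := t)
      (fun z hz => by rw [Left.sign_neg, Left.sign_neg, hPQ z hz]) ht (by rw [hd]; rfl)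
      (by simpa [Left.sign_neg] using hne)
    exact ⟨s, by simpa using hs, hfree⟩
  · exact hP.exists_root_of_dir_eq_one hZ hQ hPQ ht hd hne

/-- Two roots of `P` are separated by a point of `Z`. -/
theorem eq_of_root (hP : PiecewiseStrict Z D P) {s t : ℝ} (hs : P s = 0) (ht : P t = 0)
    (hfree : ∀ x ∈ Set.uIcc s t, x ∉ Z) : s = t := by
  have key : ∀ a b, P a = 0 → P b = 0 → (∀ x ∈ Set.Icc a b, x ∉ Z) → ¬ a < b := by
    intro a b ha hb hZ hab
    have haZ := hZ a ⟨le_rfl, hab.le⟩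
    have h := hP.sign_sub a b a hab (fun x hx => hZ x ⟨hx.1.le, hx.2.le⟩) ⟨le_rfl, hab.le⟩ haZ
    rw [ha, hb, sub_self, sign_zero] at h
    exact hP.dir_ne_zero a haZ h.symm
  rcases lt_trichotomy s t with h | h | h
  · exact absurd h (key s t hs ht (by rwa [Set.uIcc_of_le h.le] at hfree))
  · exact h
  · exact absurd h (key t s ht hs (by rwa [Set.uIcc_of_ge h.le] at hfree))

theorem sign_eq_of_common_root (hP : PiecewiseStrict Z D P) (hQ : PiecewiseStrict Z D Q) {s t : ℝ}
    (hs : P s = 0) (hs' : Q s = 0) (hfree : ∀ x ∈ Set.uIcc t s, x ∉ Z) :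
    SignType.sign (P t) = SignType.sign (Q t) := by
  have htZ := hfree t Set.left_mem_uIcc
  rcases lt_trichotomy t s with h | rfl | h
  · rw [Set.uIcc_of_le h.le] at hfree
    have h1 := hP.sign_sub t s t h (fun x hx => hfree x ⟨hx.1.le, hx.2.le⟩) ⟨le_rfl, h.le⟩ htZ
    have h2 := hQ.sign_sub t s t h (fun x hx => hfree x ⟨hx.1.le, hx.2.le⟩) ⟨le_rfl, h.le⟩ htZ
    rw [← h2, hs, hs', zero_sub, zero_sub, Left.sign_neg, Left.sign_neg] at h1
    exact neg_injective h1
  · rw [hs, hs']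
  · rw [Set.uIcc_of_ge h.le] at hfree
    have h1 := hP.sign_sub s t t h (fun x hx => hfree x ⟨hx.1.le, hx.2.le⟩) ⟨h.le, le_rfl⟩ htZ
    have h2 := hQ.sign_sub s t t h (fun x hx => hfree x ⟨hx.1.le, hx.2.le⟩) ⟨h.le, le_rfl⟩ htZ
    rwa [← h2, hs, hs', sub_zero, sub_zero] at h1

end PiecewiseStrict

open Polynomial in
theorem PiecewiseStrict.of_polynomial {P : ℝ[X]} (hP : 0 < P.natDegree) (h : ℝ ≃o ℝ) {Z : Set ℝ}
    (hZ : ∀ x, P.derivative.eval (h x) = 0 → x ∈ Z) :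
    PiecewiseStrict Z (fun x => SignType.sign (P.derivative.eval (h x)))
      (fun x => P.eval (h x)) where
  continuous := P.continuous.comp h.continuous
  tendsto_atTop := (P.abs_tendsto_atTop (natDegree_pos_iff_degree_pos.1 hP)).comp h.tendsto_atTop
  tendsto_atBot := (P.abs_tendsto_atBot (natDegree_pos_iff_degree_pos.1 hP)).comp h.tendsto_atBot
  sign_sub a b c hab hfree hc hcZ := by
    obtain ⟨y, hy, hy'⟩ := exists_deriv_eq_slope (fun x => P.eval x) (h.strictMono hab)
      P.continuous.continuousOn P.differentiable.differentiableOn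
    obtain ⟨x, rfl⟩ := h.surjective y
    rw [Polynomial.deriv, eq_div_iff (sub_pos.2 (h.strictMono hab)).ne'] at hy'
    rw [← hy', sign_mul, sign_pos (sub_pos.2 (h.strictMono hab)), mul_one]
    refine sign_eq_of_forall_ne_zero (f := fun x => P.derivative.eval (h x))
      (P.derivative.continuous.comp h.continuous) fun z hz hz0 => ?_
    have hx : x ∈ Set.Ioo a b := ⟨h.lt_iff_lt.1 hy.1, h.lt_iff_lt.1 hy.2⟩
    rcases eq_or_ne z c with rfl | hzc
    · exact hcZ (hZ _ hz0)
    · refine hfree z ?_ (hZ z hz0)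
      rw [Set.mem_uIcc] at hz
      rcases hz with hz | hz
      · exact ⟨hx.1.trans_le hz.1, (lt_of_le_of_ne hz.2 hzc).trans_le hc.2⟩
      · exact ⟨hc.1.trans_lt (lt_of_le_of_ne hz.1 hzc.symm), hz.2.trans_lt hx.2⟩
  dir_ne_zero c hc h0 := hc (hZ c (sign_eq_zero_iff.1 h0))

theorem exists_Ioo_of_uIcc {Z : Set ℝ} (hZ : Z.Finite) {s t : ℝ}
    (h : ∀ x ∈ Set.uIcc s t, x ∉ Z) :
    ∃ a b, s ∈ Set.Ioo a b ∧ t ∈ Set.Ioo a b ∧ ∀ x ∈ Set.Ioo a b, x ∉ Z := by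
  have hopen : IsOpen Zᶜ := hZ.isClosed.isOpen_compl
  have hmin : min s t ∈ Zᶜ := h _ ⟨le_rfl, min_le_max⟩
  have hmax : max s t ∈ Zᶜ := h _ ⟨min_le_max, le_rfl⟩
  obtain ⟨a, ha, ha'⟩ := exists_Ioc_subset_of_mem_nhds (hopen.mem_nhds hmin) ⟨_, sub_one_lt _⟩
  obtain ⟨b, hb, hb'⟩ := exists_Ico_subset_of_mem_nhds (hopen.mem_nhds hmax) ⟨_, lt_add_one _⟩
  refine ⟨a, b, ⟨ha.trans_le (min_le_left _ _), (le_max_left _ _).trans_lt hb⟩,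
    ⟨ha.trans_le (min_le_right _ _), (le_max_right _ _).trans_lt hb⟩, fun x hx => ?_⟩
  rcases le_or_gt x (min s t) with h1 | h1
  · exact ha' ⟨hx.1, h1⟩
  · rcases le_or_gt (max s t) x with h2 | h2
    · exact hb' ⟨h2, hx.2⟩
    · exact h x ⟨h1.le, h2.le⟩

open Polynomial in
/-- An order automorphism of `ℝ` matching the signs of the polynomials `A i` with those of `B i`
can be modified so that it also matches the signs of `P` and `Q`, provided that derivatives occur
among the given polynomials and that the signs of `P` and `Q` at their roots are known to agree. -/
theorem exists_orderIso_sign_eq {ι : Type*} (G : Finset ι) (A B : ι → ℝ[X]) {P Q : ℝ[X]}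
    (hP : 0 < P.natDegree) (hQ : 0 < Q.natDegree)
    (hder : ∃ i ∈ G, A i = P.derivative ∧ B i = Q.derivative)
    (hroot : ∀ s t, (∀ i ∈ G, SignType.sign ((A i).eval s) = SignType.sign ((B i).eval t)) →
      (∃ i ∈ G, A i ≠ 0 ∧ (A i).eval s = 0) → SignType.sign (P.eval s) = SignType.sign (Q.eval t))
    (h₀ : ℝ ≃o ℝ)
    (hsign₀ : ∀ i ∈ G, ∀ t, SignType.sign ((A i).eval t) = SignType.sign ((B i).eval (h₀ t))) :
    ∃ h : ℝ ≃o ℝ,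
      (∀ i ∈ G, ∀ t, SignType.sign ((A i).eval t) = SignType.sign ((B i).eval (h t))) ∧
      ∀ t, SignType.sign (P.eval t) = SignType.sign (Q.eval (h t)) := by
  classical
  obtain ⟨j, hjG, hAj, hBj⟩ := hder
  have hP' : P.derivative ≠ 0 := fun h => hP.ne' (derivative_eq_zero.1 h)
  set Z : Set ℝ := {x | ∃ i ∈ G, A i ≠ 0 ∧ (A i).eval x = 0} with hZdef
  have hZ : Z.Finite := by
    have : Z ⊆ ⋃ i ∈ G, ((A i).roots.toFinset : Set ℝ) := by
      rintro x ⟨i, hi, hi0, hix⟩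
      simp only [Set.mem_iUnion]
      exact ⟨i, hi, by simpa [hi0] using hix⟩
    exact (G.finite_toSet.biUnion fun i _ => Finset.finite_toSet _).subset this
  have hsignZ : ∀ i ∈ G, ∀ s t, (∀ x ∈ Set.uIcc s t, x ∉ Z) →
      SignType.sign ((A i).eval s) = SignType.sign ((A i).eval t) := by
    intro i hi s t hst
    by_cases h0 : A i = 0
    · simp [h0]
    · exact sign_eq_of_forall_ne_zero (A i).continuous fun x hx hx0 => hst x hx ⟨i, hi, h0, hx0⟩
  have hPS : PiecewiseStrict Z (fun x => SignType.sign (P.derivative.eval x)) (fun x => P.eval x) :=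
    PiecewiseStrict.of_polynomial hP (OrderIso.refl ℝ) fun x hx =>
      ⟨j, hjG, by rwa [hAj], by rw [hAj]; exact hx⟩
  have hQS : ∀ h : ℝ ≃o ℝ,
      (∀ i ∈ G, ∀ t, SignType.sign ((A i).eval t) = SignType.sign ((B i).eval (h t))) →
      PiecewiseStrict Z (fun x => SignType.sign (P.derivative.eval x)) (fun x => Q.eval (h x)) := by
    intro h hs
    have hd : ∀ x, SignType.sign (P.derivative.eval x) = SignType.sign (Q.derivative.eval (h x)) :=
      fun x => by rw [← hAj, ← hBj, hs j hjG]
    simp_rw [hd]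
    refine PiecewiseStrict.of_polynomial hQ h fun x hx => ⟨j, hjG, by rwa [hAj], ?_⟩
    rw [hAj, ← sign_eq_zero_iff, hd, hx, sign_zero]
  have hZroot : ∀ h : ℝ ≃o ℝ,
      (∀ i ∈ G, ∀ t, SignType.sign ((A i).eval t) = SignType.sign ((B i).eval (h t))) →
      ∀ z ∈ Z, SignType.sign (P.eval z) = SignType.sign (Q.eval (h z)) :=
    fun h hs z hz => hroot z (h z) (fun i hi => hs i hi z) hz
  have key : ∀ T : Finset ℝ, (∀ r ∈ T, P.eval r = 0) → ∃ h : ℝ ≃o ℝ,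
      (∀ i ∈ G, ∀ t, SignType.sign ((A i).eval t) = SignType.sign ((B i).eval (h t))) ∧
      ∀ r ∈ T, Q.eval (h r) = 0 := by
    intro T
    induction T using Finset.induction_on with
    | empty => exact fun _ => ⟨h₀, hsign₀, by simp⟩
    | insert r T hrT ih =>
      intro hT
      obtain ⟨h, hs, hr⟩ := ih fun r hr => hT r (Finset.mem_insert_of_mem hr)
      have hPr : P.eval r = 0 := hT r (Finset.mem_insert_self r T)
      by_cases hQr : Q.eval (h r) = 0
      · refine ⟨h, hs, fun x hx => ?_⟩
        rcases Finset.mem_insert.1 hx with rfl | hx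
        · exact hQr
        · exact hr x hx
      have hne : SignType.sign (P.eval r) ≠ SignType.sign (Q.eval (h r)) := by
        rw [hPr, sign_zero]
        exact fun h' => hQr (sign_eq_zero_iff.1 h'.symm)
      have hrZ : r ∉ Z := fun hrZ => hne (hZroot h hs r hrZ)
      obtain ⟨s, hs0, hfree⟩ := hPS.exists_root hZ (hQS h hs) (hZroot h hs) hrZ hne
      obtain ⟨a, b, hra, hsa, hab⟩ := exists_Ioo_of_uIcc hZ hfree
      obtain ⟨g, hg, hfix⟩ := exists_orderIso_map_eq hra hsa
      have hga : g a = a := hfix a fun h => lt_irrefl _ h.1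
      have hgb : g b = b := hfix b fun h => lt_irrefl _ h.2
      refine ⟨g.trans h, fun i hi t => ?_, fun x hx => ?_⟩
      · rw [OrderIso.trans_apply, ← hs i hi]
        by_cases ht : t ∈ Set.Ioo a b
        · have hgt : g t ∈ Set.Ioo a b :=
            ⟨by rw [← hga]; exact g.strictMono ht.1, by rw [← hgb]; exact g.strictMono ht.2⟩
          exact hsignZ i hi _ _ fun x hx => hab x (Set.ordConnected_Ioo.uIcc_subset ht hgt hx)
        · rw [hfix t ht]
      · rw [OrderIso.trans_apply]
        rcases Finset.mem_insert.1 hx with rfl | hxT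
        · rw [hg]; exact hs0
        · rw [hfix x fun hxa => ?_]
          · exact hr x hxT
          · have : x = r := hPS.eq_of_root (hT x hx) hPr fun y hy =>
              hab y (Set.ordConnected_Ioo.uIcc_subset hxa hra hy)
            exact hrT (this ▸ hxT)
  have hP0 : P ≠ 0 := by rintro rfl; simp at hP
  obtain ⟨h, hs, hr⟩ := key P.roots.toFinset fun r hr => by simpa [hP0] using hr
  refine ⟨h, hs, fun t => ?_⟩
  by_contra hne
  have htZ : t ∉ Z := fun htZ => hne (hZroot h hs t htZ)
  obtain ⟨s, hs0, hfree⟩ := (hQS h hs).exists_root hZ hPS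
    (fun z hz => (hZroot h hs z hz).symm) htZ (Ne.symm hne)
  exact hne (hPS.sign_eq_of_common_root (hQS h hs) hs0 (hr s (by simpa [hP0] using hs0)) hfree)

open Polynomial in
/-- Division with remainder by `q` becomes possible after multiplication by a power of the leading
coefficient of `q`. -/
theorem exists_pseudo_remainder {R : Type*} [CommRing R] (p : R[X]) {q : R[X]}
    (hq : 0 < q.natDegree) :
    ∃ r : R[X], r.natDegree < q.natDegree ∧ ∃ (k : ℕ) (a : R[X]),
      C q.leadingCoeff ^ k * p = a * q + r := by
  induction hn : p.natDegree using Nat.strong_induction_on generalizing p with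
  | _ n ih =>
    by_cases hpq : p.natDegree < q.natDegree
    · exact ⟨p, hpq, 0, 0, by simp⟩
    rw [not_lt] at hpq
    set p₁ := C q.leadingCoeff * p - C p.leadingCoeff * X ^ (p.natDegree - q.natDegree) * q
      with hp₁
    have hdeg : p₁.natDegree ≤ p.natDegree := by
      refine (natDegree_sub_le _ _).trans (max_le (natDegree_C_mul_le _ _) ?_)
      refine natDegree_mul_le.trans ?_
      have := natDegree_C_mul_X_pow_le p.leadingCoeff (p.natDegree - q.natDegree)
      omega
    have hcoeff : p₁.coeff p.natDegree = 0 := by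
      rw [hp₁, coeff_sub, coeff_C_mul, mul_assoc, coeff_C_mul, coeff_X_pow_mul',
        if_pos (Nat.sub_le _ _), Nat.sub_sub_self hpq, coeff_natDegree, coeff_natDegree]
      ring
    have hlt : p₁.natDegree < p.natDegree := by
      refine lt_of_le_of_ne hdeg fun h => ?_
      rw [← h, coeff_natDegree, leadingCoeff_eq_zero] at hcoeff
      rw [hcoeff, natDegree_zero] at h
      omega
    obtain ⟨r, hr, k, a, h⟩ := ih p₁.natDegree (hn ▸ hlt) p₁ rfl
    refine ⟨r, hr, k + 1, a + C q.leadingCoeff ^ k *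
      (C p.leadingCoeff * X ^ (p.natDegree - q.natDegree)), ?_⟩
    rw [hp₁] at h
    linear_combination h

section Reductions

open Polynomial

variable {R : Type*} [CommRing R]

open Classical in
/-- A remainder of `p` modulo a nonconstant `q`, up to powers of the leading coefficient of `q`. -/
noncomputable def pseudoRem (p q : R[X]) : R[X] :=
  if hq : 0 < q.natDegree then (exists_pseudo_remainder p hq).choose else 0

theorem natDegree_pseudoRem_lt (p : R[X]) {q : R[X]} (hq : 0 < q.natDegree) :
    (pseudoRem p q).natDegree < q.natDegree := by
  rw [pseudoRem, dif_pos hq]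
  exact (exists_pseudo_remainder p hq).choose_spec.1

theorem exists_eq_mul_add_pseudoRem (p : R[X]) {q : R[X]} (hq : 0 < q.natDegree) :
    ∃ (k : ℕ) (a : R[X]), C q.leadingCoeff ^ k * p = a * q + pseudoRem p q := by
  rw [pseudoRem, dif_pos hq]
  exact (exists_pseudo_remainder p hq).choose_spec.2

/-- The polynomials of smaller degree than `q` that control the signs of `q`, and the signs of `p`
at the roots of `q`. -/
def reductions (p q : R[X]) : Set R[X] :=
  {derivative q, q.eraseLead, C q.leadingCoeff, pseudoRem p q}

theorem natDegree_lt_of_mem_reductions {p q r : R[X]} (hq : 0 < q.natDegree)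
    (hr : r ∈ reductions p q) : r.natDegree < q.natDegree := by
  rcases hr with rfl | rfl | rfl | rfl
  · exact natDegree_derivative_lt hq.ne'
  · have := q.eraseLead_natDegree_le
    omega
  · rwa [natDegree_C]
  · exact natDegree_pseudoRem_lt p hq

theorem finite_reductions (p q : R[X]) : (reductions p q).Finite := by
  simp [reductions]

/-- Closure under `reductions`, as far as divisors of degree at least `d` are concerned. -/
def ReductionClosed (d : ℕ) (F : Set R[X]) : Prop :=
  ∀ p ∈ F, ∀ q ∈ F, 0 < q.natDegree → d ≤ q.natDegree → q.natDegree ≤ p.natDegree →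
    reductions p q ⊆ F

theorem exists_reductionClosed (F : Finset R[X]) :
    ∃ F' : Finset R[X], F ⊆ F' ∧ ReductionClosed 0 (F' : Set R[X]) := by
  classical
  refine Nat.decreasingInduction (n := F.sup natDegree + 1)
    (motive := fun d _ => ∃ F' : Finset R[X], F ⊆ F' ∧ ReductionClosed d (F' : Set R[X]))
    (fun d _ ⟨F', hF, hcl⟩ => ?_) ⟨F, subset_rfl, ?_⟩ (Nat.zero_le _)
  · set E : Set R[X] := {r | ∃ p ∈ F', ∃ q ∈ F', 0 < q.natDegree ∧ q.natDegree = d ∧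
      r ∈ reductions p q} with hE
    have hEfin : E.Finite := by
      refine (F'.finite_toSet.biUnion fun p _ => F'.finite_toSet.biUnion fun q _ =>
        finite_reductions p q).subset ?_
      rintro r ⟨p, hp, q, hq, -, -, hr⟩
      simp only [Set.mem_iUnion]
      exact ⟨p, hp, q, hq, hr⟩
    have hEdeg : ∀ r ∈ E, r.natDegree < d := by
      rintro r ⟨p, hp, q, hq, hq0, rfl, hr⟩
      exact natDegree_lt_of_mem_reductions hq0 hr
    refine ⟨F' ∪ hEfin.toFinset, hF.trans Finset.subset_union_left, ?_⟩
    intro p hp q hq hq0 hdq hqp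
    simp only [Finset.coe_union, Set.Finite.coe_toFinset] at hp hq ⊢
    have hp' : p ∈ F' := hp.resolve_right fun h => by
      have := hEdeg p h
      omega
    have hq' : q ∈ F' := hq.resolve_right fun h => by
      have := hEdeg q h
      omega
    rcases hdq.eq_or_lt with h | h
    · exact fun r hr => Or.inr ⟨p, hp', q, hq', hq0, h.symm, hr⟩
    · exact (hcl p hp' q hq' hq0 h hqp).trans Set.subset_union_left
  · intro p hp q hq _ hdq _
    have := Finset.le_sup (f := natDegree) (Finset.mem_coe.1 hq)
    omega

theorem map_eraseLead_of_eq_zero {S : Type*} [CommRing S] (f : R →+* S) {p : R[X]}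
    (h : f p.leadingCoeff = 0) : p.eraseLead.map f = p.map f := by
  simp [← self_sub_C_mul_X_pow, h]

/-- For a finite family of polynomials closed under `reductions`, the signs of the constants of the
family determine the arrangement of signs on the real line. -/
theorem ReductionClosed.exists_orderIso {F : Finset R[X]} (hF : ReductionClosed 0 (F : Set R[X]))
    {f g : R →+* ℝ}
    (hfg : ∀ c, C c ∈ F → SignType.sign (f c) = SignType.sign (g c)) :
    ∃ h : ℝ ≃o ℝ, ∀ p ∈ F, ∀ t,
      SignType.sign ((p.map f).eval t) = SignType.sign ((p.map g).eval (h t)) := by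
  let hdec : DecidableEq R[X] := Classical.decEq _
  induction F using Finset.induction_on_max_value (ι := R[X]) (α := ℕ) natDegree with
  | empty => exact ⟨OrderIso.refl ℝ, by simp⟩
  | insert p F hpF hmax ih =>
    have hred : ∀ a ∈ insert p F, ∀ b ∈ insert p F, 0 < b.natDegree → b.natDegree ≤ a.natDegree →
        ∀ r ∈ reductions a b, r ∈ F := by
      intro a ha b hb hb0 hba r hr
      have h1 := hF a (Finset.mem_coe.2 ha) b (Finset.mem_coe.2 hb) hb0 (Nat.zero_le _) hba hr
      refine (Finset.mem_insert.1 (Finset.mem_coe.1 h1)).resolve_left ?_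
      rintro rfl
      have h2 := natDegree_lt_of_mem_reductions hb0 hr
      rcases Finset.mem_insert.1 hb with rfl | hb
      · exact lt_irrefl _ h2
      · exact absurd (hmax b hb) (not_le.2 h2)
    have hconst : ∀ c, C c ∈ F → SignType.sign (f c) = SignType.sign (g c) :=
      fun c hc => hfg c (Finset.mem_insert_of_mem hc)
    have hFcl : ReductionClosed 0 (F : Set R[X]) := fun a ha b hb hb0 _ hba r hr =>
      Finset.mem_coe.2 (hred a (Finset.mem_insert_of_mem (Finset.mem_coe.1 ha)) b
        (Finset.mem_insert_of_mem (Finset.mem_coe.1 hb)) hb0 hba r hr)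
    obtain ⟨h, hs⟩ := ih hFcl hconst
    rcases Nat.eq_zero_or_pos p.natDegree with hp0 | hp0
    · refine ⟨h, fun q hq t => ?_⟩
      rcases Finset.mem_insert.1 hq with rfl | hq
      · obtain ⟨c, rfl⟩ := natDegree_eq_zero.1 hp0
        simpa using hfg c (Finset.mem_insert_self (C c) F)
      · exact hs q hq t
    have hpred := hred p (Finset.mem_insert_self p F) p (Finset.mem_insert_self p F) hp0 le_rfl
    have hlead := hconst p.leadingCoeff (hpred _ (by simp [reductions]))
    by_cases hf0 : f p.leadingCoeff = 0
    · have hg0 : g p.leadingCoeff = 0 := by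
        rw [hf0, sign_zero] at hlead
        exact sign_eq_zero_iff.1 hlead.symm
      refine ⟨h, fun q hq t => ?_⟩
      rcases Finset.mem_insert.1 hq with rfl | hq
      · rw [← map_eraseLead_of_eq_zero f hf0, ← map_eraseLead_of_eq_zero g hg0]
        exact hs _ (hpred _ (by simp [reductions])) t
      · exact hs q hq t
    have hg0 : g p.leadingCoeff ≠ 0 := by
      intro hg0
      rw [hg0, sign_zero] at hlead
      exact hf0 (sign_eq_zero_iff.1 hlead)
    have hroot : ∀ s t,
        (∀ q ∈ F, SignType.sign ((q.map f).eval s) = SignType.sign ((q.map g).eval t)) →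
        (∃ q ∈ F, q.map f ≠ 0 ∧ (q.map f).eval s = 0) →
        SignType.sign ((p.map f).eval s) = SignType.sign ((p.map g).eval t) := by
      rintro s t hst ⟨q₀, hq₀F, hq₀, hq₀s⟩
      obtain ⟨q, hq, hmin⟩ := Finset.exists_min_image
        (F.filter fun q => q.map f ≠ 0 ∧ (q.map f).eval s = 0) natDegree
        ⟨q₀, by simp only [Finset.mem_filter]; exact ⟨hq₀F, hq₀, hq₀s⟩⟩
      simp only [Finset.mem_filter] at hq hmin
      obtain ⟨hqF, hq0, hqs⟩ := hq
      have hqpos : 0 < q.natDegree := by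
        refine Nat.pos_of_ne_zero fun hq' => ?_
        obtain ⟨c, rfl⟩ := natDegree_eq_zero.1 hq'
        rw [map_C, eval_C] at hqs
        rw [map_C, hqs, C_0] at hq0
        exact hq0 rfl
      have hqF' : q ∈ insert p F := Finset.mem_insert_of_mem hqF
      have hqred := hred p (Finset.mem_insert_self p F) q hqF' hqpos (hmax q hqF)
      have hqlead := hconst q.leadingCoeff (hqred _ (by simp [reductions]))
      have hqf0 : f q.leadingCoeff ≠ 0 := by
        intro h0
        have he := map_eraseLead_of_eq_zero f h0
        have h1 := hmin q.eraseLead ⟨hqred _ (by simp [reductions]), by rwa [he], by rwa [he]⟩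
        have h2 := natDegree_lt_of_mem_reductions (p := p) (r := q.eraseLead) hqpos
          (by simp [reductions])
        omega
      have hqt : (q.map g).eval t = 0 := by
        have := hst q hqF
        rw [hqs, sign_zero] at this
        exact sign_eq_zero_iff.1 this.symm
      have hr := hst (pseudoRem p q) (hqred _ (by simp [reductions]))
      obtain ⟨k, a, hka⟩ := exists_eq_mul_add_pseudoRem p hqpos
      have e1 : (f q.leadingCoeff) ^ k * (p.map f).eval s = ((pseudoRem p q).map f).eval s := by
        have := congrArg (fun r => (r.map f).eval s) hka
        simpa [hqs] using this
      have e2 : (g q.leadingCoeff) ^ k * (p.map g).eval t = ((pseudoRem p q).map g).eval t := by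
        have := congrArg (fun r => (r.map g).eval t) hka
        simpa [hqt] using this
      rw [← e1, ← e2, sign_mul, sign_mul, sign_pow, sign_pow, ← hqlead] at hr
      exact mul_left_cancel₀ (pow_ne_zero k (sign_ne_zero.2 hqf0)) hr
    obtain ⟨h', hs', hsp⟩ := exists_orderIso_sign_eq F (fun q => q.map f) (fun q => q.map g)
      (P := p.map f) (Q := p.map g)
      (by rwa [natDegree_map_of_leadingCoeff_ne_zero f hf0])
      (by rwa [natDegree_map_of_leadingCoeff_ne_zero g hg0])
      ⟨derivative p, hpred _ (by simp [reductions]), (derivative_map p f).symm,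
        (derivative_map p g).symm⟩ hroot h hs
    refine ⟨h', fun q hq t => ?_⟩
    rcases Finset.mem_insert.1 hq with rfl | hq
    · exact hsp t
    · exact hs' q hq t

/-- Tarski–Seidenberg: the signs that a finite set of polynomials takes simultaneously on the real
line are determined by the signs of finitely many elements of the coefficient ring. -/
theorem exists_finset_sign_eval (F : Finset R[X]) :
    ∃ G : Finset R, ∀ f g : R →+* ℝ,
      (∀ c ∈ G, SignType.sign (f c) = SignType.sign (g c)) → ∀ t, ∃ t', ∀ p ∈ F,
        SignType.sign (eval₂RingHom f t p) = SignType.sign (eval₂RingHom g t' p) := by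
  classical
  obtain ⟨F', hF, hcl⟩ := exists_reductionClosed F
  refine ⟨F'.image fun p => p.coeff 0, fun f g hfg t => ?_⟩
  obtain ⟨h, hs⟩ := hcl.exists_orderIso (f := f) (g := g) fun c hc =>
    hfg c (Finset.mem_image.2 ⟨C c, hc, coeff_C_zero⟩)
  refine ⟨h t, fun p hp => ?_⟩
  simpa only [coe_eval₂RingHom, eval_map] using hs p (hF hp) t

end Reductions

section Realize

open Polynomial

variable {R : Type} [CommRing R] {α : Type*}

/-- The complex number whose real and imaginary parts are the images of `z.1` and `z.2`. -/
def complexPoint (f : R →+* ℝ) (z : R × R) : ℂ := ⟨f z.1, f z.2⟩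

theorem exists_realize_term_eq (a : α → R × R) (t : cLang.Term α) :
    ∃ z : R × R, ∀ f : R →+* ℝ, t.realize (fun i => complexPoint f (a i)) = complexPoint f z := by
  induction t with
  | var i => exact ⟨a i, fun _ => rfl⟩
  | func F ts ih =>
    choose z hz using ih
    simp only [Term.realize, hz]
    cases F with
    | zero => exact ⟨(0, 0), fun f => by apply Complex.ext <;> simp [complexPoint, Structure.funMap]⟩
    | one => exact ⟨(1, 0), fun f => by apply Complex.ext <;> simp [complexPoint, Structure.funMap]⟩
    | add =>
      exact ⟨((z 0).1 + (z 1).1, (z 0).2 + (z 1).2), fun f => by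
        apply Complex.ext <;> simp [complexPoint, Structure.funMap]⟩
    | mul =>
      exact ⟨((z 0).1 * (z 1).1 - (z 0).2 * (z 1).2, (z 0).1 * (z 1).2 + (z 0).2 * (z 1).1),
        fun f => by apply Complex.ext <;> simp [complexPoint, Structure.funMap]⟩
    | star =>
      exact ⟨((z 0).1, -(z 0).2), fun f => by
        apply Complex.ext <;> simp [complexPoint, Structure.funMap]⟩

theorem sign_eq_imp_eq_zero_iff {x y : ℝ} (h : SignType.sign x = SignType.sign y) :
    x = 0 ↔ y = 0 := by
  rw [← sign_eq_zero_iff, h, sign_eq_zero_iff]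

theorem sign_eq_imp_nonneg_iff {x y : ℝ} (h : SignType.sign x = SignType.sign y) :
    0 ≤ x ↔ 0 ≤ y := by
  rw [← sign_nonneg_iff, h, sign_nonneg_iff]

/-- The truth of a formula at points with coordinates in a ring specialized to `ℝ` only depends on
the signs of finitely many elements of the ring. -/
theorem exists_finset_sign_realize {n : ℕ} (φ : cLang.BoundedFormula α n) :
    ∀ {R : Type} [CommRing R] (a : α → R × R) (b : Fin n → R × R), ∃ G : Finset R,
      ∀ f g : R →+* ℝ, (∀ c ∈ G, SignType.sign (f c) = SignType.sign (g c)) →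
      (φ.Realize (fun i => complexPoint f (a i)) (fun i => complexPoint f (b i)) ↔
        φ.Realize (fun i => complexPoint g (a i)) (fun i => complexPoint g (b i))) := by
  classical
  have helim : ∀ {R : Type} [CommRing R] {n : ℕ} (a : α → R × R) (b : Fin n → R × R)
      (f : R →+* ℝ), Sum.elim (fun i => complexPoint f (a i)) (fun i => complexPoint f (b i)) =
        fun i => complexPoint f (Sum.elim a b i) := by
    intro R _ n a b f
    funext i
    cases i <;> rfl
  induction φ with
  | falsum => exact fun _ _ => ⟨∅, fun _ _ _ => Iff.rfl⟩
  | equal t₁ t₂ =>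
    intro R _ a b
    obtain ⟨z, hz⟩ := exists_realize_term_eq (Sum.elim a b) t₁
    obtain ⟨w, hw⟩ := exists_realize_term_eq (Sum.elim a b) t₂
    refine ⟨{z.1 - w.1, z.2 - w.2}, fun f g hfg => ?_⟩
    have h1 := sign_eq_imp_eq_zero_iff (hfg (z.1 - w.1) (by simp))
    have h2 := sign_eq_imp_eq_zero_iff (hfg (z.2 - w.2) (by simp))
    simp only [map_sub, sub_eq_zero] at h1 h2
    simp only [BoundedFormula.Realize, helim, hz, hw]
    simp only [complexPoint, Complex.ext_iff, h1, h2]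
  | rel r ts =>
    intro R _ a b
    choose z hz using fun i => exists_realize_term_eq (Sum.elim a b) (ts i)
    cases r with
    | le =>
      refine ⟨{(z 0).2, (z 1).2, (z 1).1 - (z 0).1}, fun f g hfg => ?_⟩
      have h1 := sign_eq_imp_eq_zero_iff (hfg (z 0).2 (by simp))
      have h2 := sign_eq_imp_eq_zero_iff (hfg (z 1).2 (by simp))
      have h3 := sign_eq_imp_nonneg_iff (hfg ((z 1).1 - (z 0).1) (by simp))
      simp only [map_sub, sub_nonneg] at h3
      simp only [BoundedFormula.Realize, helim, hz]
      simp only [Structure.RelMap, complexPoint, h1, h2, h3]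
  | imp φ ψ ihφ ihψ =>
    intro R _ a b
    obtain ⟨G, hG⟩ := ihφ a b
    obtain ⟨H, hH⟩ := ihψ a b
    refine ⟨G ∪ H, fun f g hfg => ?_⟩
    rw [BoundedFormula.realize_imp, BoundedFormula.realize_imp,
      hG f g fun c hc => hfg c (Finset.mem_union_left _ hc),
      hH f g fun c hc => hfg c (Finset.mem_union_right _ hc)]
  | all φ ih =>
    intro R _ a b
    obtain ⟨F, hF⟩ := ih (R := R[X][X]) (fun i => (C (C (a i).1), C (C (a i).2)))
      (Fin.snoc (fun i => (C (C (b i).1), C (C (b i).2))) (C X, X))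
    obtain ⟨G, hG⟩ := exists_finset_sign_eval F
    obtain ⟨H, hH⟩ := exists_finset_sign_eval G
    have key : ∀ f g : R →+* ℝ, (∀ c ∈ H, SignType.sign (f c) = SignType.sign (g c)) →
        φ.all.Realize (fun i => complexPoint g (a i)) (fun i => complexPoint g (b i)) →
        φ.all.Realize (fun i => complexPoint f (a i)) (fun i => complexPoint f (b i)) := by
      intro f g hfg hg
      rw [BoundedFormula.realize_all] at hg ⊢
      intro z
      obtain ⟨s, hs⟩ := hH f g hfg z.re
      obtain ⟨t, ht⟩ := hG _ _ hs z.im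
      have hpt : ∀ (f : R →+* ℝ) (x y : ℝ),
          (fun i => complexPoint (eval₂RingHom (eval₂RingHom f x) y)
            ((Fin.snoc (fun i => (C (C (b i).1), C (C (b i).2))) (C X, X) :
              Fin _ → R[X][X] × R[X][X]) i)) =
          Fin.snoc (fun i => complexPoint f (b i)) (⟨x, y⟩ : ℂ) := by
        intro f x y
        funext i
        refine Fin.lastCases ?_ (fun i => ?_) i
        · simp [complexPoint]
        · simp [complexPoint]
      have h := hF _ _ ht
      rw [hpt, hpt] at h
      simp only [complexPoint, coe_eval₂RingHom, eval₂_C] at h hg ⊢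
      exact h.2 (hg _)
    exact ⟨H, fun f g hfg => ⟨key g f fun c hc => (hfg c hc).symm, key f g hfg⟩⟩

end Realize

/-- Complex conjugation is an automorphism of the `cLang`-structure `ℂ`. -/
noncomputable def conjEquiv : cLang.Equiv ℂ ℂ where
  toEquiv := (starRingAut : ℂ ≃+* ℂ).toEquiv
  map_fun' {n} F x := by
    cases F <;> simp [Structure.funMap]
  map_rel' {n} r x := by
    cases r
    simp [Structure.RelMap]

theorem realize_conj {α : Type*} (φ : cLang.Formula α) (v : α → ℂ) :
    φ.Realize (fun i => starRingEnd ℂ (v i)) ↔ φ.Realize v :=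
  StrongHomClass.realize_formula conjEquiv φ

section QuantifierFree

/-- The sum of two terms. -/
def sumTerm {α : Type*} (a b : cLang.Term α) : cLang.Term α :=
  Term.func (L := cLang) (l := 2) CFunc.add ![a, b]

/-- The product of two terms. -/
def prodTerm {α : Type*} (a b : cLang.Term α) : cLang.Term α :=
  Term.func (L := cLang) (l := 2) CFunc.mul ![a, b]

/-- The conjugate of a term. -/
def conjTerm {α : Type*} (a : cLang.Term α) : cLang.Term α :=
  Term.func (L := cLang) (l := 1) CFunc.star ![a]

/-- The term `0`. -/
def zeroTerm (α : Type*) : cLang.Term α :=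
  Term.func (L := cLang) (l := 0) CFunc.zero ![]

/-- The term `1`. -/
def oneTerm (α : Type*) : cLang.Term α :=
  Term.func (L := cLang) (l := 0) CFunc.one ![]

theorem realize_sumTerm {α : Type*} (a b : cLang.Term α) (v : α → ℂ) :
    (sumTerm a b).realize v = a.realize v + b.realize v := rfl

theorem realize_prodTerm {α : Type*} (a b : cLang.Term α) (v : α → ℂ) :
    (prodTerm a b).realize v = a.realize v * b.realize v := rfl

theorem realize_conjTerm {α : Type*} (a : cLang.Term α) (v : α → ℂ) :
    (conjTerm a).realize v = starRingEnd ℂ (a.realize v) := rfl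

/-- The ring of functions that are differences of `cLang`-terms. -/
def termDiff (α : Type*) : Subring ((α → ℂ) → ℂ) where
  carrier := {f | ∃ a b : cLang.Term α, ∀ v, f v = a.realize v - b.realize v}
  zero_mem' := ⟨zeroTerm α, zeroTerm α, fun _ => (sub_self _).symm⟩
  one_mem' := ⟨oneTerm α, zeroTerm α, fun _ => (sub_zero _).symm⟩
  add_mem' := by
    rintro f g ⟨a, b, hf⟩ ⟨c, d, hg⟩
    refine ⟨sumTerm a c, sumTerm b d, fun v => ?_⟩
    rw [Pi.add_apply, hf, hg, realize_sumTerm, realize_sumTerm]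
    ring
  mul_mem' := by
    rintro f g ⟨a, b, hf⟩ ⟨c, d, hg⟩
    refine ⟨sumTerm (prodTerm a c) (prodTerm b d), sumTerm (prodTerm a d) (prodTerm b c),
      fun v => ?_⟩
    simp only [Pi.mul_apply, hf, hg, realize_sumTerm, realize_prodTerm]
    ring
  neg_mem' := by
    rintro f ⟨a, b, hf⟩
    exact ⟨b, a, fun v => by rw [Pi.neg_apply, hf, neg_sub]⟩

variable {α : Type*}

theorem var_mem_termDiff (i : α) : (fun v => v i) ∈ termDiff α :=
  ⟨.var i, zeroTerm α, fun _ => (sub_zero _).symm⟩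

theorem conj_var_mem_termDiff (i : α) : (fun v => starRingEnd ℂ (v i)) ∈ termDiff α :=
  ⟨conjTerm (.var i), zeroTerm α, fun _ => (sub_zero _).symm⟩

/-- Sets defined by quantifier-free `cLang`-formulas. -/
def IsQFDefinable (S : Set (α → ℂ)) : Prop :=
  ∃ ψ : cLang.Formula α, ψ.IsQF ∧ ∀ v, ψ.Realize v ↔ v ∈ S

theorem isQFDefinable_empty : IsQFDefinable (∅ : Set (α → ℂ)) :=
  ⟨⊥, .falsum, fun _ => Iff.rfl⟩

theorem IsQFDefinable.himp {S T : Set (α → ℂ)} (hS : IsQFDefinable S) (hT : IsQFDefinable T) :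
    IsQFDefinable {v | v ∈ S → v ∈ T} := by
  obtain ⟨φ, hφ, hφ'⟩ := hS
  obtain ⟨ψ, hψ, hψ'⟩ := hT
  exact ⟨φ.imp ψ, hφ.imp hψ, fun v => by rw [Formula.realize_imp, hφ', hψ']; rfl⟩

theorem IsQFDefinable.compl {S : Set (α → ℂ)} (hS : IsQFDefinable S) : IsQFDefinable Sᶜ :=
  hS.himp isQFDefinable_empty

theorem IsQFDefinable.union {S T : Set (α → ℂ)} (hS : IsQFDefinable S) (hT : IsQFDefinable T) :
    IsQFDefinable (S ∪ T) := by
  convert hS.compl.himp hT using 1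
  ext v
  exact or_iff_not_imp_left

theorem IsQFDefinable.inter {S T : Set (α → ℂ)} (hS : IsQFDefinable S) (hT : IsQFDefinable T) :
    IsQFDefinable (S ∩ T) := by
  rw [← compl_compl (S ∩ T), Set.compl_inter]
  exact (hS.compl.union hT.compl).compl

theorem isQFDefinable_of_finset (I : Finset (Set (α → ℂ))) (hI : ∀ S ∈ I, IsQFDefinable S)
    (D : Set (α → ℂ)) (hD : ∀ v w, (∀ S ∈ I, v ∈ S ↔ w ∈ S) → (v ∈ D ↔ w ∈ D)) :
    IsQFDefinable D := by
  classical
  induction I using Finset.induction_on generalizing D with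
  | empty =>
    rcases D.eq_empty_or_nonempty with rfl | ⟨w, hw⟩
    · exact isQFDefinable_empty
    · rw [show D = ∅ᶜ from (Set.eq_univ_of_forall fun v => (hD v w (by simp)).2 hw).trans
        Set.compl_empty.symm]
      exact isQFDefinable_empty.compl
  | insert S I _ ih =>
    have hS := hI S (Finset.mem_insert_self S I)
    have key : ∀ T : Set (α → ℂ),
        IsQFDefinable {v | ∃ w ∈ D ∩ T, ∀ S ∈ I, v ∈ S ↔ w ∈ S} := fun T =>
      ih (fun S' hS' => hI S' (Finset.mem_insert_of_mem hS')) _ fun v w hvw =>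
        exists_congr fun u => and_congr_right fun _ =>
          forall₂_congr fun S' hS' => by rw [hvw S' hS']
    convert (hS.inter (key S)).union (hS.compl.inter (key Sᶜ)) using 1
    ext v
    constructor
    · intro hv
      by_cases hvS : v ∈ S
      · exact Or.inl ⟨hvS, v, ⟨hv, hvS⟩, fun _ _ => Iff.rfl⟩
      · exact Or.inr ⟨hvS, v, ⟨hv, hvS⟩, fun _ _ => Iff.rfl⟩
    · rintro (⟨hvS, w, ⟨hwD, hwS⟩, hvw⟩ | ⟨hvS, w, ⟨hwD, hwS⟩, hvw⟩)
      · refine (hD v w fun S' hS' => ?_).2 hwD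
        rcases Finset.mem_insert.1 hS' with rfl | hS'
        · exact iff_of_true hvS hwS
        · exact hvw S' hS'
      · refine (hD v w fun S' hS' => ?_).2 hwD
        rcases Finset.mem_insert.1 hS' with rfl | hS'
        · exact iff_of_false hvS hwS
        · exact hvw S' hS'

theorem isQFDefinable_nonneg {k : (α → ℂ) → ℝ} (hk : (fun v => (k v : ℂ)) ∈ termDiff α) :
    IsQFDefinable {v | 0 ≤ k v} := by
  obtain ⟨a, b, hab⟩ := hk
  refine ⟨Relations.formula (L := cLang) (n := 2) CRel.le
    ![sumTerm b (conjTerm b), sumTerm a (conjTerm b)], .of_isAtomic (.rel _ _), fun v => ?_⟩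
  have him := congrArg Complex.im (hab v)
  have hre := congrArg Complex.re (hab v)
  simp only [Complex.ofReal_im, Complex.ofReal_re, Complex.sub_im, Complex.sub_re] at him hre
  refine Formula.realize_rel.trans ?_
  change ((sumTerm b (conjTerm b)).realize v).im = 0 ∧
    ((sumTerm a (conjTerm b)).realize v).im = 0 ∧
    ((sumTerm b (conjTerm b)).realize v).re ≤ ((sumTerm a (conjTerm b)).realize v).re ↔ 0 ≤ k v
  simp only [realize_sumTerm, realize_conjTerm, Complex.add_im, Complex.add_re, Complex.conj_im,
    Complex.conj_re]
  constructor
  · rintro ⟨-, -, h⟩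
    linarith
  · intro h
    refine ⟨?_, ?_, ?_⟩ <;> linarith

theorem sign_eq_of_nonneg_iff {x y : ℝ} (h : 0 ≤ x ↔ 0 ≤ y) (h' : 0 ≤ -x ↔ 0 ≤ -y) :
    SignType.sign x = SignType.sign y := by
  simp only [sign_apply, ← not_le]
  simp only [neg_nonneg] at h'
  simp only [h, h']

theorem isQFDefinable_of_sign (K : Finset ((α → ℂ) → ℝ))
    (hK : ∀ k ∈ K, (fun v => (k v : ℂ)) ∈ termDiff α) (D : Set (α → ℂ))
    (hD : ∀ v w, (∀ k ∈ K, SignType.sign (k v) = SignType.sign (k w)) → (v ∈ D ↔ w ∈ D)) :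
    IsQFDefinable D := by
  classical
  refine isQFDefinable_of_finset
    (K.image (fun k => {v | 0 ≤ k v}) ∪ K.image (fun k => {v | 0 ≤ - k v})) ?_ D fun v w h => ?_
  · intro S hS
    simp only [Finset.mem_union, Finset.mem_image] at hS
    rcases hS with ⟨k, hk, rfl⟩ | ⟨k, hk, rfl⟩
    · exact isQFDefinable_nonneg (hK k hk)
    · refine isQFDefinable_nonneg (k := fun v => - k v) ?_
      simp only [Complex.ofReal_neg]
      exact (termDiff α).neg_mem (hK k hk)
  · exact hD v w fun k hk => sign_eq_of_nonneg_iff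
      (h {v | 0 ≤ k v} (Finset.mem_union_left _ (Finset.mem_image_of_mem _ hk)))
      (h {v | 0 ≤ - k v} (Finset.mem_union_right _
        (Finset.mem_image_of_mem (fun k : (α → ℂ) → ℝ => {v | 0 ≤ - k v}) hk)))

/-- The ring of real functions whose even part, and whose odd part multiplied by the imaginary
unit, are differences of terms up to an integer factor. Parity refers to complex conjugation. -/
def parityRing (α : Type*) : Subring ((α → ℂ) → ℝ) where
  carrier := {p | ∃ N : ℕ, 0 < N ∧
    (fun v => ((N * (p v + p fun i => starRingEnd ℂ (v i)) : ℝ) : ℂ)) ∈ termDiff α ∧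
    (fun v => ((N * (p v - p fun i => starRingEnd ℂ (v i)) : ℝ) : ℂ) * Complex.I) ∈ termDiff α}
  zero_mem' := ⟨1, one_pos, by convert (termDiff α).zero_mem using 1; ext v; simp,
    by convert (termDiff α).zero_mem using 1; ext v; simp⟩
  one_mem' := ⟨1, one_pos, by
    convert (termDiff α).add_mem (termDiff α).one_mem (termDiff α).one_mem using 1
    ext v
    simp, by convert (termDiff α).zero_mem using 1; ext v; simp⟩
  add_mem' := by
    rintro p q ⟨M, hM, hp, hp'⟩ ⟨N, hN, hq, hq'⟩
    refine ⟨M * N, Nat.mul_pos hM hN, ?_, ?_⟩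
    · convert (termDiff α).add_mem (nsmul_mem hp N) (nsmul_mem hq M) using 1
      ext v
      simp only [Pi.add_apply, Pi.smul_apply]
      simp only [nsmul_eq_mul]
      push_cast
      ring
    · convert (termDiff α).add_mem (nsmul_mem hp' N) (nsmul_mem hq' M) using 1
      ext v
      simp only [Pi.add_apply, Pi.smul_apply]
      simp only [nsmul_eq_mul]
      push_cast
      ring
  mul_mem' := by
    rintro p q ⟨M, hM, hp, hp'⟩ ⟨N, hN, hq, hq'⟩
    refine ⟨2 * (M * N), Nat.mul_pos two_pos (Nat.mul_pos hM hN), ?_, ?_⟩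
    · convert (termDiff α).sub_mem ((termDiff α).mul_mem hp hq)
        ((termDiff α).mul_mem hp' hq') using 1
      ext v
      simp only [Pi.mul_apply, Pi.sub_apply]
      push_cast
      linear_combination (M : ℂ) * N * (p v - p fun i => starRingEnd ℂ (v i)) *
        (q v - q fun i => starRingEnd ℂ (v i)) * Complex.I_sq
    · convert (termDiff α).add_mem ((termDiff α).mul_mem hp hq')
        ((termDiff α).mul_mem hp' hq) using 1
      ext v
      simp only [Pi.mul_apply, Pi.add_apply]
      push_cast
      ring
  neg_mem' := by
    rintro p ⟨M, hM, hp, hp'⟩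
    refine ⟨M, hM, ?_, ?_⟩
    · convert (termDiff α).neg_mem hp using 1
      ext v
      simp only [Pi.neg_apply]
      push_cast
      ring
    · convert (termDiff α).neg_mem hp' using 1
      ext v
      simp only [Pi.neg_apply]
      push_cast
      ring

theorem re_mem_parityRing (i : α) : (fun v => (v i).re) ∈ parityRing α := by
  refine ⟨1, one_pos, ?_, ?_⟩
  · convert (termDiff α).add_mem (var_mem_termDiff i) (conj_var_mem_termDiff i) using 1
    ext v
    apply Complex.ext <;> simp
  · convert (termDiff α).zero_mem using 1
    ext v
    simp

theorem im_mem_parityRing (i : α) : (fun v => (v i).im) ∈ parityRing α := by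
  refine ⟨1, one_pos, ?_, ?_⟩
  · convert (termDiff α).zero_mem using 1
    ext v
    simp
  · convert (termDiff α).sub_mem (var_mem_termDiff i) (conj_var_mem_termDiff i) using 1
    ext v
    apply Complex.ext <;> simp

theorem sign_add_eq {a b a' b' : ℝ} (ha : SignType.sign a = SignType.sign a')
    (hb : SignType.sign b = SignType.sign b')
    (hab : SignType.sign (a ^ 2 - b ^ 2) = SignType.sign (a' ^ 2 - b' ^ 2)) :
    SignType.sign (a + b) = SignType.sign (a' + b') := by
  have aux : ∀ {a b a' b' : ℝ}, SignType.sign a = SignType.sign a' →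
      SignType.sign b = SignType.sign b' →
      SignType.sign (a ^ 2 - b ^ 2) = SignType.sign (a' ^ 2 - b' ^ 2) → 0 ≤ a + b → 0 ≤ a' + b' := by
    intro a b a' b' ha hb hab h
    have ha1 := sign_eq_imp_nonneg_iff ha
    have hb1 := sign_eq_imp_nonneg_iff hb
    have hab1 := sign_eq_imp_nonneg_iff hab
    have hab2 := sign_eq_imp_nonneg_iff (x := -(a ^ 2 - b ^ 2)) (y := -(a' ^ 2 - b' ^ 2))
      (by rw [Left.sign_neg, Left.sign_neg, hab])
    rcases le_or_gt 0 a with h1 | h1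
    · have h1' := ha1.1 h1
      rcases le_or_gt 0 b with h2 | h2
      · exact add_nonneg h1' (hb1.1 h2)
      · have h2' : b' < 0 := not_le.1 fun h' => not_le.2 h2 (hb1.2 h')
        have := hab1.1 (by nlinarith)
        nlinarith
    · have h1' : a' < 0 := not_le.1 fun h' => not_le.2 h1 (ha1.2 h')
      have h2' := hb1.1 (by linarith)
      have := hab2.1 (by nlinarith)
      nlinarith
  refine sign_eq_of_nonneg_iff ⟨aux ha hb hab, aux ha.symm hb.symm hab.symm⟩ ?_
  have hneg : ∀ {x y : ℝ}, SignType.sign x = SignType.sign y →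
      SignType.sign (-x) = SignType.sign (-y) := fun h => by
    rw [Left.sign_neg, Left.sign_neg, h]
  rw [neg_add, neg_add]
  exact ⟨aux (hneg ha) (hneg hb) (by simpa only [neg_sq] using hab),
    aux (hneg ha.symm) (hneg hb.symm) (by simpa only [neg_sq] using hab.symm)⟩

/-- If the products `x i * x j` have the same signs as `y i * y j`, then the signs of the `x i` are
those of the `y i` up to a global change of sign. -/
theorem sign_eq_or_sign_eq_neg {ι : Type*} {F : Finset ι} {x y : ι → ℝ}
    (h : ∀ i ∈ F, ∀ j ∈ F, SignType.sign (x i * x j) = SignType.sign (y i * y j)) :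
    (∀ i ∈ F, SignType.sign (x i) = SignType.sign (y i)) ∨
      ∀ i ∈ F, SignType.sign (x i) = SignType.sign (-y i) := by
  simp only [sign_mul] at h
  simp only [Left.sign_neg]
  by_contra! hne
  obtain ⟨⟨i, hi, h1⟩, ⟨j, hj, h2⟩⟩ := hne
  have hii := h i hi i hi
  have hij := h i hi j hj
  have hjj := h j hj j hj
  generalize SignType.sign (x i) = a at *
  generalize SignType.sign (x j) = b at *
  generalize SignType.sign (y i) = c at *
  generalize SignType.sign (y j) = d at *
  clear h
  revert h1 h2 hii hij hjj
  revert a b c d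
  decide

theorem isQFDefinable_setOf_realize {α : Type} (φ : cLang.Formula α) :
    IsQFDefinable {v | φ.Realize v} := by
  classical
  let ev : (α → ℂ) → parityRing α →+* ℝ := fun v =>
    (Pi.evalRingHom (fun _ : α → ℂ => ℝ) v).comp (parityRing α).subtype
  obtain ⟨F, hF⟩ := exists_finset_sign_realize φ
    (fun i => (⟨_, re_mem_parityRing i⟩, ⟨_, im_mem_parityRing i⟩) :
      α → parityRing α × parityRing α) (fun i => (0, 0))
  have hdet : ∀ v w, (∀ p ∈ F, SignType.sign (p.1 v) = SignType.sign (p.1 w)) →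
      (φ.Realize v ↔ φ.Realize w) := by
    intro v w hvw
    have hreal : ∀ u, φ.Realize u ↔ BoundedFormula.Realize φ (fun i => complexPoint (ev u)
        (⟨_, re_mem_parityRing i⟩, ⟨_, im_mem_parityRing i⟩))
        (fun _ => complexPoint (ev u) (0, 0)) := fun u =>
      iff_of_eq (congrArg₂ (BoundedFormula.Realize φ) (funext fun i => Complex.ext rfl rfl)
        (Subsingleton.elim _ _))
    rw [hreal, hreal]
    exact hF (ev v) (ev w) hvw
  choose N hN hA hB using fun p : parityRing α => p.2
  let c : (α → ℂ) → α → ℂ := fun v i => starRingEnd ℂ (v i)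
  have hcc : ∀ v, c (c v) = v := fun v => funext fun i => Complex.conj_conj (v i)
  let A : parityRing α → (α → ℂ) → ℝ := fun p v => N p * (p.1 v + p.1 (c v))
  let B : parityRing α → (α → ℂ) → ℝ := fun p v => N p * (p.1 v - p.1 (c v))
  have hsign : ∀ p v, SignType.sign (p.1 v) = SignType.sign (A p v + B p v) := by
    intro p v
    have : A p v + B p v = (2 * N p : ℝ) * p.1 v := by
      simp only [A, B]
      ring
    rw [this, sign_mul, sign_pos (mul_pos two_pos (Nat.cast_pos.2 (hN p))), one_mul]
  have hAc : ∀ p v, A p (c v) = A p v := fun p v => by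
    simp only [A, hcc]
    ring
  have hBc : ∀ p v, B p (c v) = - B p v := fun p v => by
    simp only [B, hcc]
    ring
  refine isQFDefinable_of_sign
    ((F.image A ∪ F.image fun p v => A p v ^ 2 - B p v ^ 2) ∪
      (F ×ˢ F).image fun pq v => B pq.1 v * B pq.2 v) ?_ _ fun v w h => ?_
  · have hBB : ∀ p q, (fun v => ((B p v * B q v : ℝ) : ℂ)) ∈ termDiff α := by
      intro p q
      convert (termDiff α).neg_mem ((termDiff α).mul_mem (hB p) (hB q)) using 1
      ext v
      simp only [Pi.neg_apply, Pi.mul_apply]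
      change _ = -(((B p v : ℝ) : ℂ) * Complex.I * (((B q v : ℝ) : ℂ) * Complex.I))
      rw [Complex.ofReal_mul]
      linear_combination ((B p v : ℝ) : ℂ) * ((B q v : ℝ) : ℂ) * Complex.I_sq
    intro k hk
    simp only [Finset.mem_union, Finset.mem_image] at hk
    rcases hk with (⟨p, -, rfl⟩ | ⟨p, -, rfl⟩) | ⟨pq, -, rfl⟩
    · exact hA p
    · convert (termDiff α).sub_mem ((termDiff α).mul_mem (hA p) (hA p)) (hBB p p) using 1
      ext v
      simp only [Pi.sub_apply, Pi.mul_apply]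
      change _ = ((A p v : ℝ) : ℂ) * ((A p v : ℝ) : ℂ) - _
      push_cast
      ring
    · exact hBB pq.1 pq.2
  · have h1 : ∀ p ∈ F, SignType.sign (A p v) = SignType.sign (A p w) := fun p hp =>
      h (A p) (Finset.mem_union_left _ (Finset.mem_union_left _ (Finset.mem_image_of_mem A hp)))
    have h2 : ∀ p ∈ F,
        SignType.sign (A p v ^ 2 - B p v ^ 2) = SignType.sign (A p w ^ 2 - B p w ^ 2) :=
      fun p hp => h (fun v => A p v ^ 2 - B p v ^ 2) (Finset.mem_union_left _
        (Finset.mem_union_right _ (Finset.mem_image.2 ⟨p, hp, rfl⟩)))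
    have h3 : ∀ p ∈ F, ∀ q ∈ F,
        SignType.sign (B p v * B q v) = SignType.sign (B p w * B q w) :=
      fun p hp q hq => h (fun v => B p v * B q v) (Finset.mem_union_right _
        (Finset.mem_image.2 ⟨(p, q), Finset.mk_mem_product hp hq, rfl⟩))
    rcases sign_eq_or_sign_eq_neg h3 with h4 | h4
    · refine hdet v w fun p hp => ?_
      rw [hsign, hsign]
      exact sign_add_eq (h1 p hp) (h4 p hp) (h2 p hp)
    · refine (hdet v (c w) fun p hp => ?_).trans (realize_conj φ w)
      rw [hsign, hsign, hAc, hBc]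
      exact sign_add_eq (h1 p hp) (h4 p hp) (by simpa only [neg_sq] using h2 p hp)

end QuantifierFree

/-- The `cLang`-structure `ℂ` admits quantifier elimination: every formula is equivalent
to a quantifier-free formula in the same free variables. -/
theorem complex_conj_order_qe (m : ℕ) (φ : cLang.Formula (Fin m)) :
    ∃ ψ : cLang.Formula (Fin m), ψ.IsQF ∧
      ∀ v : Fin m → ℂ, φ.Realize v ↔ ψ.Realize v := by
  obtain ⟨ψ, hψ, h⟩ := isQFDefinable_setOf_realize φ
  exact ⟨ψ, hψ, fun v => (h v).symm⟩
end
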